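/- Let m be a multisegment and [a,b] a segment with b > a. If D_{[a]}(m) = ∞, then I^Lang_{[a,b]}(m) = I_{[a]}(I^Lang_{[a+1,b]}(m)). -/

import Mathlib

namespace Multiseg

/-- A segment `[a,b]` on a fixed cuspidal line, encoded by its endpoints. -/
abbrev Seg := ℤ × ℤ

/-- A multiset of pairs is a multisegment when each pair is a genuine segment. -/
def IsMS (m : Multiset Seg) : Prop := ∀ Δ ∈ m, Δ.1 ≤ Δ.2

/-- `Δ ≺ Δ'` : the segment `Δ` precedes `Δ'`. -/
def Prec (Δ Δ' : Seg) : Prop := Δ.1 < Δ'.1 ∧ Δ.2 < Δ'.2 ∧ Δ'.1 ≤ Δ.2 + 1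

instance : DecidableRel Prec := fun _ _ => by unfold Prec; infer_instance

/-- `Δ ⊆ Δ'` as segments. -/
def SSub (Δ Δ' : Seg) : Prop := Δ'.1 ≤ Δ.1 ∧ Δ.2 ≤ Δ'.2

/-- `m[i]`, the segments of `m` starting at `i`. -/
def startAt (m : Multiset Seg) (i : ℤ) : Multiset Seg := m.filter fun Δ => Δ.1 = i

/-- `m⟨i⟩`, the segments of `m` ending at `i`. -/
def endAt (m : Multiset Seg) (i : ℤ) : Multiset Seg := m.filter fun Δ => Δ.2 = i

/-- `m_{[a,b]} = {[a',b'] ∈ m : a ≤ a' ≤ b+1 ≤ b'+1}`. -/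
def mRange (m : Multiset Seg) (a b : ℤ) : Multiset Seg :=
  m.filter fun Δ => a ≤ Δ.1 ∧ Δ.1 ≤ b + 1 ∧ b ≤ Δ.2

/-- Add the segment `[x,y]` to `m`, discarding it if it is void. -/
def pushSeg (m : Multiset Seg) (x y : ℤ) : Multiset Seg :=
  if x ≤ y then m + {(x, y)} else m

def msetMax (s : Multiset ℤ) : Option ℤ :=
  if h : s = 0 then none else some (s.toFinset.max' (Multiset.toFinset_nonempty.mpr h))

def msetMin (s : Multiset ℤ) : Option ℤ :=
  if h : s = 0 then none else some (s.toFinset.min' (Multiset.toFinset_nonempty.mpr h))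

/-- The longest segment of `m[i]`, if any. -/
def longStart (m : Multiset Seg) (i : ℤ) : Option Seg :=
  (msetMax ((startAt m i).map Prod.snd)).map fun y => (i, y)

/-- The shortest segment of `m[i]`, if any. -/
def shortStart (m : Multiset Seg) (i : ℤ) : Option Seg :=
  (msetMin ((startAt m i).map Prod.snd)).map fun y => (i, y)

/-- The longest segment of `m⟨i⟩`, if any. -/
def longEnd (m : Multiset Seg) (i : ℤ) : Option Seg :=
  (msetMin ((endAt m i).map Prod.fst)).map fun x => (x, i)

/-- The shortest segment of `m⟨i⟩`, if any. -/
def shortEnd (m : Multiset Seg) (i : ℤ) : Option Seg :=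
  (msetMax ((endAt m i).map Prod.fst)).map fun x => (x, i)

/-- One removal step of the `tds(·,c)` process: remove the longest segment `Δ''`
of `m[c+1]` and the longest segment `Δ'` of `m[c]` with `Δ' ≺ Δ''`. -/
def tdsStep (m : Multiset Seg) (c : ℤ) : Option (Multiset Seg) :=
  match longStart m (c + 1) with
  | none => none
  | some Δ'' =>
    match msetMax (((startAt m c).filter fun Δ => Prec Δ Δ'').map Prod.snd) with
    | none => none
    | some y => some ((m.erase (c, y)).erase Δ'')

def tdsIterF (c : ℤ) : ℕ → Multiset Seg → Multiset Seg
  | 0, m => m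
  | n + 1, m =>
    match tdsStep m c with
    | none => m
    | some m' => tdsIterF c n m'

/-- Iterate the `tds(·,c)` process until it terminates. -/
def tdsIter (c : ℤ) (m : Multiset Seg) : Multiset Seg := tdsIterF c m.card m

/-- The `ρ`-derivative algorithm `𝒟_{[a]}`; the value `none` codes `∞`. -/
def Drho (a : ℤ) (m : Multiset Seg) : Option (Multiset Seg) :=
  (shortStart (tdsIter a m) a).map fun Δ => pushSeg (m.erase Δ) (a + 1) Δ.2

/-- `ε_{[a]}(m)`, the number of segments starting at `a` left after the
`tds(·,a)` process terminates. -/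
def epsA (a : ℤ) (m : Multiset Seg) : ℕ := (startAt (tdsIter a m) a).card

/-- The next element of an upward sequence after `p`. -/
def usNext (n : Multiset Seg) (p : Seg) : Option Seg :=
  match msetMin ((n.filter fun Δ => Prec p Δ).map Prod.fst) with
  | none => none
  | some aj =>
    (msetMax ((((n.filter fun Δ => Prec p Δ).filter fun Δ => Δ.1 = aj)).map Prod.snd)).map
      fun y => (aj, y)

def usAux (n : Multiset Seg) : ℕ → Seg → List Seg
  | 0, _ => []
  | fuel + 1, p =>
    match usNext n p with
    | none => []
    | some Δ => Δ :: usAux n fuel Δ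

/-- The upward sequence `Us(n)` of maximally linked segments of `n`. -/
def usList (n : Multiset Seg) : List Seg :=
  match msetMin (n.map Prod.fst) with
  | none => []
  | some a1 =>
    match longStart n a1 with
    | none => []
    | some Δ1 => Δ1 :: usAux n n.card Δ1

/-- The decomposition of a multisegment into successive upward sequences. -/
def usDecomp : ℕ → Multiset Seg → List (List Seg)
  | 0, _ => []
  | fuel + 1, n =>
    if n = 0 then [] else usList n :: usDecomp fuel (n - (usList n : Multiset Seg))

/-- `[x,y] ⊆ [u,v]` (with the void interval contained in anything). -/
def intSubB (x y u v : ℤ) : Bool := decide (y < x) || (decide (u ≤ x) && decide (y ≤ v))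

/-- Find, in a row of an upward-sequence decomposition, the first segment `Δ`
whose removable free section contains `[s(Δ), top]`. -/
def findRowD : List Seg → ℤ → Option Seg
  | [], _ => none
  | [Δ], top => if intSubB Δ.1 top Δ.1 Δ.2 then some Δ else none
  | Δ :: Δ' :: rest, top =>
    if intSubB Δ.1 top Δ.1 (Δ'.1 - 2) then some Δ else findRowD (Δ' :: rest) top

/-- The selection step of the Langlands derivative algorithm, scanning the rows
downwards from the last one; it records each selected segment together with the
start of its truncation. -/
def selAuxD (rows : List (List Seg)) : ℕ → ℤ → List (Seg × ℤ)
  | 0, _ => []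
  | n + 1, top =>
    match findRowD (rows.getD n []) top with
    | some Δ => (Δ, top + 1) :: selAuxD rows n (Δ.1 - 1)
    | none => selAuxD rows n top

/-- The Langlands derivative algorithm `𝒟^Lang_{[a,b]}`; `none` codes `∞`. -/
def DLang (a b : ℤ) (m : Multiset Seg) : Option (Multiset Seg) :=
  let m1 := mRange m a b
  let rows := usDecomp m1.card m1
  let sel := selAuxD rows rows.length b
  match sel.getLast? with
  | none => none
  | some (Δl, _) =>
    if Δl.1 = a then
      some (sel.foldl (fun acc p => pushSeg (acc.erase p.1) p.2 p.1.2) m)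
    else none

/-- One removal step of the `tus(·,c)` process. -/
def tusStep (n : Multiset Seg) (c : ℤ) : Option (Multiset Seg) :=
  match shortStart n c with
  | none => none
  | some Δ' =>
    match msetMin (((startAt n (c + 1)).filter fun Δ => Prec Δ' Δ).map Prod.snd) with
    | none => none
    | some y => some ((n.erase Δ').erase (c + 1, y))

def tusIterF (c : ℤ) : ℕ → Multiset Seg → Multiset Seg
  | 0, n => n
  | k + 1, n =>
    match tusStep n c with
    | none => n
    | some n' => tusIterF c k n'

/-- Iterate the `tus(·,c)` process until it terminates. -/
def tusIter (c : ℤ) (n : Multiset Seg) : Multiset Seg := tusIterF c n.card n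

/-- The `ρ`-integral algorithm `ℐ_{[a]}` (always defined). -/
def Irho (a : ℤ) (n : Multiset Seg) : Multiset Seg :=
  match longStart (tusIter a n) (a + 1) with
  | none => n + {(a, a)}
  | some Δ => pushSeg (n.erase Δ) a Δ.2

/-- The next element of a downward sequence after `p`. -/
def dsNext (n : Multiset Seg) (p : Seg) : Option Seg :=
  match msetMax ((n.filter fun Δ => Prec Δ p).map Prod.fst) with
  | none => none
  | some aq => shortStart n aq

def dsAux (n : Multiset Seg) : ℕ → Seg → List Seg
  | 0, _ => []
  | k + 1, p =>
    match dsNext n p with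
    | none => []
    | some Δ => Δ :: dsAux n k Δ

/-- The downward sequence `Ds(n)` of minimal linked segments with the largest
starting. -/
def dsList (n : Multiset Seg) : List Seg :=
  match msetMax (n.map Prod.fst) with
  | none => []
  | some a1 =>
    match shortStart n a1 with
    | none => []
    | some Δ1 => Δ1 :: dsAux n n.card Δ1

/-- The decomposition of a multisegment into successive downward sequences. -/
def dsDecomp : ℕ → Multiset Seg → List (List Seg)
  | 0, _ => []
  | k + 1, n =>
    if n = 0 then [] else dsList n :: dsDecomp k (n - (dsList n : Multiset Seg))

/-- Find, in a row of a downward-sequence decomposition, the segment whose set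
of addable free points contains `pt`. -/
def findRowI (a : ℤ) : List Seg → ℤ → Option Seg
  | [], _ => none
  | [Δ], pt => if decide (a ≤ pt) && decide (pt ≤ Δ.1 - 1) then some Δ else none
  | Δ :: Δ' :: rest, pt =>
    if decide (Δ'.1 + 1 ≤ pt) && decide (pt ≤ Δ.1 - 1) then some Δ
    else findRowI a (Δ' :: rest) pt

/-- The selection step of the Langlands integral algorithm; it records each
selected segment together with the start of its extension. -/
def selAuxI (a : ℤ) (rows : List (List Seg)) : ℕ → ℤ → List (Seg × ℤ)
  | 0, _ => []
  | n + 1, pt =>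
    match findRowI a (rows.getD n []) pt with
    | some Δ => (Δ, pt) :: selAuxI a rows n Δ.1
    | none => selAuxI a rows n pt

/-- The Langlands integral algorithm `ℐ^Lang_{[a,b]}`. -/
def ILang (a b : ℤ) (m : Multiset Seg) : Multiset Seg :=
  let m1 := mRange m a b
  let rows := dsDecomp m1.card m1
  let sel := selAuxI a rows rows.length a
  let base := sel.foldl (fun acc p => pushSeg (acc.erase p.1) p.2 p.1.2) m
  match sel.getLast? with
  | none => pushSeg base a b
  | some (Δl, _) => pushSeg base Δl.1 b

/-- `m` is in good range for `[a,b]`. -/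
def GoodRange (m : Multiset Seg) (a b : ℤ) : Prop := mRange m a b = m

/-- `Θ`, the Gelfand–Kazhdan involution on multisegments. -/
def Theta (m : Multiset Seg) : Multiset Seg := m.map fun Δ => (-Δ.2, -Δ.1)

/-- The exotic duality `𝔻_r`. -/
def Dual (r : ℤ) (m : Multiset Seg) : Multiset Seg :=
  m.map fun Δ => (-r + Δ.2 + 1, Δ.1 - 1)

/-- `𝔻_r^{[a,b]}`. -/
def DualAB (r a b : ℤ) (m : Multiset Seg) : Multiset Seg := Dual r m + {(b - r + 1, b)}

/-- The left Langlands derivative algorithm `𝒟^{Lang,L}_{[a,b]}`. -/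
def DLangL (a b : ℤ) (m : Multiset Seg) : Option (Multiset Seg) :=
  (DLang (-b) (-a) (Theta m)).map Theta

/-- The left `ρ`-derivative algorithm `𝒟^{Lang,L}_{[a]}`. -/
def DrhoL (a : ℤ) (m : Multiset Seg) : Option (Multiset Seg) :=
  (Drho (-a) (Theta m)).map Theta

/-- The next segment chosen by the MW algorithm after `p`. -/
def mwNext (m : Multiset Seg) (p : Seg) : Option Seg :=
  (msetMax (((endAt m (p.2 - 1)).filter fun Δ => Prec Δ p).map Prod.fst)).map
    fun x => (x, p.2 - 1)

def mwAux (m : Multiset Seg) : ℕ → Seg → List Seg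
  | 0, _ => []
  | k + 1, p =>
    match mwNext m p with
    | none => []
    | some Δ => Δ :: mwAux m k Δ

/-- The ordered segments participating in the MW algorithm for `m`. -/
def mwList (m : Multiset Seg) : List Seg :=
  match msetMax (m.map Prod.snd) with
  | none => []
  | some b0 =>
    match shortEnd m b0 with
    | none => []
    | some Δ0 => Δ0 :: mwAux m m.card Δ0

/-- `𝒟^MW(m)`. -/
def DMW (m : Multiset Seg) : Multiset Seg :=
  (mwList m).foldl (fun acc Δ => pushSeg (acc.erase Δ) Δ.1 (Δ.2 - 1)) m

/-- The first segment `Δ(m)` produced by the MW algorithm for `m`. -/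
def mwFirstSeg (m : Multiset Seg) : Option Seg :=
  match (mwList m).head?, (mwList m).getLast? with
  | some Δ0, some Δk => some (Δk.1, Δ0.2)
  | _, _ => none

/-- The total relative length of a multisegment. -/
def totalLen (m : Multiset Seg) : ℕ := (m.map fun Δ => (Δ.2 - Δ.1 + 1).toNat).sum

def sharpAux : ℕ → Multiset Seg → Multiset Seg
  | 0, _ => 0
  | k + 1, m =>
    if m = 0 then 0
    else
      match mwFirstSeg m with
      | none => 0
      | some Δ => Δ ::ₘ sharpAux k (DMW m)

/-- The Mœglin–Waldspurger involution `m^#`. -/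
def msharp (m : Multiset Seg) : Multiset Seg := sharpAux (totalLen m) m

/-- `ε^MW_{[a,c]}(m)`, the multiplicity of `[a,c]` in `m^#`. -/
def epsMW (a c : ℤ) (m : Multiset Seg) : ℕ := (msharp m).count (a, c)

/-- `m_i`: remove from `m` the participants of the first `i` runs of the MW
algorithm. -/
def mwStage (m : Multiset Seg) : ℕ → Multiset Seg
  | 0 => m
  | i + 1 => mwStage m i - (mwList (DMW^[i] m) : Multiset Seg)

/-- `MW_k(m)`: all segments ending at `k` participating in the first `r` runs
of the MW algorithm. -/
def MWkSet (m : Multiset Seg) (r : ℕ) (k : ℤ) : Multiset Seg :=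
  ∑ i ∈ Finset.range r, (mwList (DMW^[i] m) : Multiset Seg).filter fun Δ => Δ.2 = k

def upNbrAux (m : Multiset Seg) : ℕ → Seg → Option (List Seg)
  | 0, p => some [p]
  | k + 1, p =>
    match msetMin (((endAt m (p.2 + 1)).filter fun Δ => Prec p Δ).map Prod.fst) with
    | none => none
    | some x => (upNbrAux m k (x, p.2 + 1)).map fun l => p :: l

/-- The removal upward sequence of maximal linked segments in neighbors on `m`
ranging from `a-1` to `b` (if it exists). -/
def upSeqNbr (m : Multiset Seg) (a b : ℤ) : Option (List Seg) :=
  match longEnd m (a - 1) with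
  | none => none
  | some Δ => upNbrAux m (b - (a - 1)).toNat Δ

def zelRemF (a b : ℤ) : ℕ → Multiset Seg → Multiset Seg
  | 0, m => m
  | k + 1, m =>
    match upSeqNbr m a b with
    | none => m
    | some l => zelRemF a b k (m - (l : Multiset Seg))

/-- Repeatedly remove removal upward sequences of maximal linked segments in
neighbors ranging from `a-1` to `b`, until none exists. -/
def zelRem (a b : ℤ) (m : Multiset Seg) : Multiset Seg := zelRemF a b m.card m

def zelRemCountF (a b : ℤ) : ℕ → Multiset Seg → ℕ
  | 0, _ => 0
  | k + 1, m =>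
    match upSeqNbr m a b with
    | none => 0
    | some l => zelRemCountF a b k (m - (l : Multiset Seg)) + 1

/-- The number of removal upward sequences of maximal linked segments in
neighbors ranging from `a-1` to `b` successively removed from `m`. -/
def zelRemCount (a b : ℤ) (m : Multiset Seg) : ℕ := zelRemCountF a b m.card m

def downNbrAux (m : Multiset Seg) : ℕ → Seg → Option (List Seg)
  | 0, p => some [p]
  | k + 1, p =>
    match msetMax (((endAt m (p.2 - 1)).filter fun Δ => Prec Δ p).map Prod.fst) with
    | none => none
    | some x => (downNbrAux m k (x, p.2 - 1)).map fun l => p :: l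

/-- The Zelevinsky derivative algorithm `𝒟^Zel_{[a,b]}`; `none` codes `∞`. -/
def DZel (a b : ℤ) (m : Multiset Seg) : Option (Multiset Seg) :=
  match shortEnd (zelRem a b m) b with
  | none => none
  | some Δb =>
    match downNbrAux (zelRem a b m) (b - a).toNat Δb with
    | none => none
    | some l => some (l.foldl (fun acc Δ => pushSeg (acc.erase Δ) Δ.1 (Δ.2 - 1)) m)

/-- The downward sequence of minimal linked segments in neighbors on `m`
ranging from `b` to `a-1` (if it exists). -/
def downSeqNbr (m : Multiset Seg) (a b : ℤ) : Option (List Seg) :=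
  match shortEnd m b with
  | none => none
  | some Δ => downNbrAux m (b - (a - 1)).toNat Δ

def izRemF (a b : ℤ) : ℕ → Multiset Seg → Multiset Seg
  | 0, m => m
  | k + 1, m =>
    match downSeqNbr m a b with
    | none => m
    | some l => izRemF a b k (m - (l : Multiset Seg))

/-- Repeatedly remove downward sequences of minimal linked segments in
neighbors ranging from `b` to `a-1`, until none exists. -/
def izRem (a b : ℤ) (m : Multiset Seg) : Multiset Seg := izRemF a b m.card m

def extNext (m : Multiset Seg) (p : Seg) : Option Seg :=
  (msetMin (((endAt m (p.2 + 1)).filter fun Δ => Prec p Δ).map Prod.fst)).map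
    fun x => (x, p.2 + 1)

def extAux (m : Multiset Seg) : ℕ → Option Seg → List (Option Seg)
  | 0, _ => []
  | k + 1, p =>
    let cur := p.bind (extNext m)
    cur :: extAux m k cur

/-- The (possibly void) segments `Δ̃_{a-1}, …, Δ̃_{b-1}` participating in the
extension process of the Zelevinsky integral algorithm on `m`. -/
def extList (m : Multiset Seg) (a b : ℤ) : List (Option Seg) :=
  longEnd m (a - 1) :: extAux m (b - a).toNat (longEnd m (a - 1))

def applyExt : Multiset Seg → ℤ → List (Option Seg) → Multiset Seg
  | acc, _, [] => acc
  | acc, i, some Δ :: rest => applyExt (pushSeg (acc.erase Δ) Δ.1 (Δ.2 + 1)) (i + 1) rest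
  | acc, i, none :: rest => applyExt (acc + {(i + 1, i + 1)}) (i + 1) rest

/-- The Zelevinsky integral algorithm `ℐ^Zel_{[a,b]}`. -/
def IZel (a b : ℤ) (m : Multiset Seg) : Multiset Seg :=
  applyExt m (a - 1) (extList (izRem a b m) a b)

/-- `Δ̃⁺` for a possibly void `Δ̃` at position `i` (for the void segment at
position `i` this is the singleton `[i+1,i+1]`). -/
def plusAt (i : ℤ) : Option Seg → Seg
  | some Δ => (Δ.1, Δ.2 + 1)
  | none => (i + 1, i + 1)

def plusList : ℤ → List (Option Seg) → List Seg
  | _, [] => []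
  | i, o :: rest => plusAt i o :: plusList (i + 1) rest

/-- `n₁` and `n₂` are linked by mapping: there is an injective map `f : n₁ → n₂`
with `Δ ≺ f(Δ)` for all `Δ ∈ n₁`. -/
def LinkedByMapping (n₁ n₂ : Multiset Seg) : Prop :=
  ∃ n₂' ≤ n₂, Multiset.Rel Prec n₁ n₂'

def startsSorted (n : Multiset Seg) : List ℤ := (n.map Prod.fst).sort (· ≤ ·)

/-- `n₁' < n₁` for multisegments of segments ending at a common point, compared
via their sorted lists of starting points. -/
def MSLtStarts (n₁' n₁ : Multiset Seg) : Prop :=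
  startsSorted n₁' ≠ startsSorted n₁ ∧
    List.Forall₂ (· ≤ ·) (startsSorted n₁) (startsSorted n₁')

/-- `n₁ ⊆ m⟨k-1⟩` and `n₂ ⊆ m⟨k⟩` are minimally linked in `m`. -/
def MinLinked (m : Multiset Seg) (k : ℤ) (n₁ n₂ : Multiset Seg) : Prop :=
  n₁ ≤ endAt m (k - 1) ∧ n₂ ≤ endAt m k ∧ LinkedByMapping n₁ n₂ ∧
    (∀ n₁' ≤ endAt m (k - 1), LinkedByMapping n₁' n₂ → n₁'.card ≤ n₁.card) ∧
    (∀ n₁' ≤ endAt m (k - 1), n₁'.card = n₁.card → MSLtStarts n₁' n₁ →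
      ¬LinkedByMapping n₁' n₂)

/-- The non-free sections of a row of an upward-sequence decomposition. -/
def nfRow : List Seg → Multiset Seg
  | [] => 0
  | [_] => 0
  | Δ :: Δ' :: rest => pushSeg (nfRow (Δ' :: rest)) (Δ'.1 - 1) Δ.2

/-- `𝔡(m)`, the sum of all non-free sections. -/
def frakd (m : Multiset Seg) : Multiset Seg :=
  (usDecomp m.card m).foldl (fun acc row => acc + nfRow row) 0

def DrhoPow (t : ℤ) : ℕ → Multiset Seg → Option (Multiset Seg)
  | 0, m => some m
  | k + 1, m => (Drho t m).bind (DrhoPow t k)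

/-- `(𝒟_{[a+n-1]})^{ε_{a+n-1}} ∘ ⋯ ∘ (𝒟_{[a]})^{ε_a}(m)` where at each stage `t`
the exponent is `ε_t = ε_{[t]}` of the current multisegment; `none` codes that
some derivative in the composition is `∞`. -/
def hdComp : ℕ → ℤ → Multiset Seg → Option (Multiset Seg)
  | 0, _, m => some m
  | k + 1, t, m =>
    match DrhoPow t (epsA t m) m with
    | none => none
    | some m' => hdComp k (t + 1) m'



theorem msetMax_some {s : Multiset ℤ} {x : ℤ} (h : msetMax s = some x) :
    x ∈ s ∧ ∀ y ∈ s, y ≤ x := by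
  unfold msetMax at h
  split_ifs at h with h0
  simp only [Option.some.injEq] at h
  subst h
  refine ⟨Multiset.mem_toFinset.mp (Finset.max'_mem _ _), fun y hy => ?_⟩
  exact Finset.le_max' _ _ (Multiset.mem_toFinset.mpr hy)

theorem msetMin_some {s : Multiset ℤ} {x : ℤ} (h : msetMin s = some x) :
    x ∈ s ∧ ∀ y ∈ s, x ≤ y := by
  unfold msetMin at h
  split_ifs at h with h0
  simp only [Option.some.injEq] at h
  subst h
  refine ⟨Multiset.mem_toFinset.mp (Finset.min'_mem _ _), fun y hy => ?_⟩
  exact Finset.min'_le _ _ (Multiset.mem_toFinset.mpr hy)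

theorem msetMax_none {s : Multiset ℤ} (h : msetMax s = none) : s = 0 := by
  unfold msetMax at h
  split_ifs at h with h0
  exact h0

theorem msetMin_none {s : Multiset ℤ} (h : msetMin s = none) : s = 0 := by
  unfold msetMin at h
  split_ifs at h with h0
  exact h0

theorem shortStart_some {n : Multiset Seg} {i : ℤ} {Δ : Seg} (h : shortStart n i = some Δ) :
    Δ ∈ n ∧ Δ.1 = i ∧ ∀ Δ' ∈ n, Δ'.1 = i → Δ.2 ≤ Δ'.2 := by
  unfold shortStart at h
  rw [Option.map_eq_some_iff] at h
  obtain ⟨y, hy, rfl⟩ := h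
  obtain ⟨h1, h2⟩ := msetMin_some hy
  simp only [startAt, Multiset.mem_map, Multiset.mem_filter] at h1 h2
  obtain ⟨⟨u, v⟩, ⟨h3, h4⟩, h5⟩ := h1
  simp only at h4 h5
  subst h4 h5
  exact ⟨h3, rfl, fun Δ' h6 h7 => h2 _ ⟨Δ', ⟨h6, h7⟩, rfl⟩⟩

theorem shortStart_none {n : Multiset Seg} {i : ℤ} (h : shortStart n i = none) :
    ∀ Δ ∈ n, Δ.1 ≠ i := by
  unfold shortStart at h
  rw [Option.map_eq_none_iff] at h
  have h1 := msetMin_none h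
  rw [Multiset.map_eq_zero] at h1
  intro Δ h2 h3
  have : Δ ∈ startAt n i := Multiset.mem_filter.mpr ⟨h2, h3⟩
  rw [h1] at this
  simp at this

theorem longStart_some {n : Multiset Seg} {i : ℤ} {Δ : Seg} (h : longStart n i = some Δ) :
    Δ ∈ n ∧ Δ.1 = i ∧ ∀ Δ' ∈ n, Δ'.1 = i → Δ'.2 ≤ Δ.2 := by
  unfold longStart at h
  rw [Option.map_eq_some_iff] at h
  obtain ⟨y, hy, rfl⟩ := h
  obtain ⟨h1, h2⟩ := msetMax_some hy
  simp only [startAt, Multiset.mem_map, Multiset.mem_filter] at h1 h2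
  obtain ⟨⟨u, v⟩, ⟨h3, h4⟩, h5⟩ := h1
  simp only at h4 h5
  subst h4 h5
  exact ⟨h3, rfl, fun Δ' h6 h7 => h2 _ ⟨Δ', ⟨h6, h7⟩, rfl⟩⟩

theorem longStart_none {n : Multiset Seg} {i : ℤ} (h : longStart n i = none) :
    ∀ Δ ∈ n, Δ.1 ≠ i := by
  unfold longStart at h
  rw [Option.map_eq_none_iff] at h
  have h1 := msetMax_none h
  rw [Multiset.map_eq_zero] at h1
  intro Δ h2 h3
  have : Δ ∈ startAt n i := Multiset.mem_filter.mpr ⟨h2, h3⟩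
  rw [h1] at this
  simp at this

/-- Number of segments starting at `a+1` and ending after `t`. -/
def GX (a : ℤ) (n : Multiset Seg) (t : ℤ) : ℕ := n.countP fun Δ => Δ.1 = a + 1 ∧ t < Δ.2
/-- Number of segments starting at `a` and ending at or after `t`. -/
def GY (a : ℤ) (n : Multiset Seg) (t : ℤ) : ℕ := n.countP fun Δ => Δ.1 = a ∧ t ≤ Δ.2
/-- Number of segments starting at `i`. -/
def CS (i : ℤ) (n : Multiset Seg) : ℕ := n.countP fun Δ => Δ.1 = i

theorem GX_le_CS (a t : ℤ) (n : Multiset Seg) : GX a n t ≤ CS (a + 1) n := by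
  unfold GX CS
  rw [Multiset.countP_eq_card_filter, Multiset.countP_eq_card_filter]
  exact Multiset.card_le_card (Multiset.monotone_filter_right _ fun _ h => h.1)

theorem GY_le_CS (a t : ℤ) (n : Multiset Seg) : GY a n t ≤ CS a n := by
  unfold GY CS
  rw [Multiset.countP_eq_card_filter, Multiset.countP_eq_card_filter]
  exact Multiset.card_le_card (Multiset.monotone_filter_right _ fun _ h => h.1)

theorem GX_eq_CS {a t : ℤ} {n : Multiset Seg} (h : ∀ Δ ∈ n, Δ.1 = a + 1 → t < Δ.2) :
    GX a n t = CS (a + 1) n := by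
  unfold GX CS
  refine Multiset.countP_congr rfl fun Δ hΔ => ?_
  simpa using h Δ hΔ

theorem GY_eq_CS {a t : ℤ} {n : Multiset Seg} (h : ∀ Δ ∈ n, Δ.1 = a → t ≤ Δ.2) :
    GY a n t = CS a n := by
  unfold GY CS
  refine Multiset.countP_congr rfl fun Δ hΔ => ?_
  simpa using h Δ hΔ

theorem GX_anti (a : ℤ) (n : Multiset Seg) {s t : ℤ} (h : s ≤ t) : GX a n t ≤ GX a n s := by
  unfold GX
  rw [Multiset.countP_eq_card_filter, Multiset.countP_eq_card_filter]
  exact Multiset.card_le_card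
    (Multiset.monotone_filter_right _ fun _ h' => ⟨h'.1, lt_of_le_of_lt h h'.2⟩)

theorem GY_anti (a : ℤ) (n : Multiset Seg) {s t : ℤ} (h : s ≤ t) : GY a n t ≤ GY a n s := by
  unfold GY
  rw [Multiset.countP_eq_card_filter, Multiset.countP_eq_card_filter]
  exact Multiset.card_le_card
    (Multiset.monotone_filter_right _ fun _ h' => ⟨h'.1, le_trans h h'.2⟩)

theorem GX_congr {a s t : ℤ} {n : Multiset Seg}
    (h : ∀ Δ ∈ n, Δ.1 = a + 1 → (s < Δ.2 ↔ t < Δ.2)) : GX a n s = GX a n t := by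
  unfold GX
  refine Multiset.countP_congr rfl fun Δ hΔ => ?_
  have := h Δ hΔ
  simp only [eq_iff_iff]
  tauto

theorem GX_add (a t : ℤ) (n n' : Multiset Seg) : GX a (n + n') t = GX a n t + GX a n' t :=
  Multiset.countP_add _ _ _
theorem GY_add (a t : ℤ) (n n' : Multiset Seg) : GY a (n + n') t = GY a n t + GY a n' t :=
  Multiset.countP_add _ _ _
theorem CS_add (a : ℤ) (n n' : Multiset Seg) : CS a (n + n') = CS a n + CS a n' :=
  Multiset.countP_add _ _ _
theorem GX_cons (a t : ℤ) (Δ : Seg) (n : Multiset Seg) :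
    GX a (Δ ::ₘ n) t = GX a n t + if Δ.1 = a + 1 ∧ t < Δ.2 then 1 else 0 :=
  Multiset.countP_cons _ _ _
theorem GY_cons (a t : ℤ) (Δ : Seg) (n : Multiset Seg) :
    GY a (Δ ::ₘ n) t = GY a n t + if Δ.1 = a ∧ t ≤ Δ.2 then 1 else 0 :=
  Multiset.countP_cons _ _ _
theorem CS_cons (a : ℤ) (Δ : Seg) (n : Multiset Seg) :
    CS a (Δ ::ₘ n) = CS a n + if Δ.1 = a then 1 else 0 :=
  Multiset.countP_cons _ _ _
theorem GX_zero' {a t : ℤ} {n : Multiset Seg} (h : ∀ Δ ∈ n, ¬ (Δ.1 = a + 1 ∧ t < Δ.2)) :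
    GX a n t = 0 := Multiset.countP_eq_zero.mpr h
theorem GY_zero' {a t : ℤ} {n : Multiset Seg} (h : ∀ Δ ∈ n, ¬ (Δ.1 = a ∧ t ≤ Δ.2)) :
    GY a n t = 0 := Multiset.countP_eq_zero.mpr h
theorem CS_zero' {a : ℤ} {n : Multiset Seg} (h : ∀ Δ ∈ n, ¬ (Δ.1 = a)) :
    CS a n = 0 := Multiset.countP_eq_zero.mpr h

/-- The Hall condition. -/
def Hall (a : ℤ) (n : Multiset Seg) : Prop := ∀ t, GY a n t ≤ GX a n t

theorem hall_of_tds (a : ℤ) (k : ℕ) : ∀ m : Multiset Seg,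
    (∀ Δ ∈ tdsIterF a k m, Δ.1 ≠ a) → Hall a m := by
  have base : ∀ m : Multiset Seg, (∀ Δ ∈ m, Δ.1 ≠ a) → Hall a m := by
    intro m h t
    rw [GY_zero' fun Δ hΔ h' => h Δ hΔ h'.1]
    exact Nat.zero_le _
  induction k with
  | zero => intro m h; exact base m h
  | succ k ih =>
    intro m h
    unfold tdsIterF at h
    cases hs : tdsStep m a with
    | none => rw [hs] at h; exact base m h
    | some m' =>
      rw [hs] at h
      have ihm := ih m' h
      unfold tdsStep at hs
      cases h1 : longStart m (a + 1) with
      | none => simp [h1] at hs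
      | some Δ2 =>
        simp only [h1] at hs
        cases h2 : msetMax (((startAt m a).filter fun Δ => Prec Δ Δ2).map Prod.snd) with
        | none => simp [h2] at hs
        | some y =>
          simp only [h2, Option.some.injEq] at hs
          obtain ⟨h3, h4, -⟩ := longStart_some h1
          obtain ⟨h5, -⟩ := msetMax_some h2
          simp only [startAt, Multiset.mem_map, Multiset.mem_filter] at h5
          obtain ⟨⟨u, v⟩, ⟨⟨h6, h7⟩, h8⟩, h9⟩ := h5
          simp only at h7 h9
          subst h7 h9
          have hne : Δ2 ≠ (u, v) := by
            rintro rfl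
            simp at h4
          have e1 : m = (u, v) ::ₘ Δ2 ::ₘ m' := by
            rw [← hs, Multiset.cons_erase ((Multiset.mem_erase_of_ne hne).mpr h3),
              Multiset.cons_erase h6]
          intro t
          have := ihm t
          rw [e1, GX_cons, GX_cons, GY_cons, GY_cons]
          obtain ⟨q1, q2, q3⟩ := h8
          simp only at q1 q2 q3
          split_ifs <;> simp_all <;> omega

theorem hall_of_Drho {a : ℤ} {m : Multiset Seg} (h : Drho a m = none) : Hall a m := by
  unfold Drho at h
  rw [Option.map_eq_none_iff] at h
  exact hall_of_tds a _ m (shortStart_none h)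

theorem tus_spec (a w : ℤ) (k : ℕ) : ∀ n : Multiset Seg, n.card ≤ k → (a + 1, w) ∈ n →
    (∀ Δ ∈ n, Δ.1 = a → a ≤ Δ.2) → GX a n w = GY a n w →
    (∀ t, GY a n t + (if t < w then 1 else 0) ≤ GX a n t) →
    longStart (tusIterF a k n) (a + 1) = some (a + 1, w) := by
  induction k with
  | zero =>
    intro n h1 h2
    have : n = 0 := by simpa using h1
    subst this; simp at h2
  | succ k ih =>
    intro n hk hw hms heq hH
    have key : ∀ {y : ℤ}, (a, y) ∈ n → 1 ≤ GY a n y := by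
      intro y hy
      exact Multiset.countP_pos.mpr ⟨_, hy, by simp⟩
    unfold tusIterF
    cases hs : tusStep n a with
    | none =>
      unfold tusStep at hs
      cases h1 : shortStart n a with
      | none =>
        have h2 := shortStart_none h1
        have h3 : GY a n w = 0 := GY_zero' fun Δ hΔ h' => h2 Δ hΔ h'.1
        rw [h3] at heq
        cases h4 : longStart n (a + 1) with
        | none => exact absurd rfl (longStart_none h4 _ hw)
        | some Δ =>
          obtain ⟨h5, h6, h7⟩ := longStart_some h4
          have h8 := h7 _ hw rfl
          have h9 : ¬ (w < Δ.2) := fun h => (Multiset.countP_eq_zero.mp heq Δ h5) ⟨h6, h⟩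
          simp only at h8
          simp only [Option.some.injEq]
          exact Prod.ext h6 (by simp only; omega)
      | some Δ1 =>
        exfalso
        simp only [h1] at hs
        obtain ⟨h2, h3, h4⟩ := shortStart_some h1
        cases h5 : msetMin (((startAt n (a + 1)).filter fun Δ => Prec Δ1 Δ).map Prod.snd) with
        | some y => simp [h5] at hs
        | none =>
          have h6 := msetMin_none h5
          rw [Multiset.map_eq_zero] at h6
          obtain ⟨u, y⟩ := Δ1
          simp only at h3
          subst h3
          have h7 := key h2
          have h8 := hH y
          have h9 : 0 < GX u n y := by omega
          obtain ⟨Δ, q1, q2, q3⟩ := Multiset.countP_pos.mp h9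
          have : Δ ∈ (startAt n (u + 1)).filter fun Δ => Prec (u, y) Δ := by
            have := hms _ h2 rfl
            simp only at this
            refine Multiset.mem_filter.mpr ⟨Multiset.mem_filter.mpr ⟨q1, q2⟩, ?_⟩
            unfold Prec
            simp only
            omega
          rw [h6] at this
          simp at this
    | some n' =>
      simp only
      unfold tusStep at hs
      cases h1 : shortStart n a with
      | none => simp [h1] at hs
      | some Δ1 =>
        simp only [h1] at hs
        obtain ⟨h2, h3, h4⟩ := shortStart_some h1
        cases h5 : msetMin (((startAt n (a + 1)).filter fun Δ => Prec Δ1 Δ).map Prod.snd) with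
        | none => simp [h5] at hs
        | some x =>
          simp only [h5, Option.some.injEq] at hs
          obtain ⟨u, y⟩ := Δ1
          simp only at h3
          subst h3
          simp only at h4
          obtain ⟨h6, h7⟩ := msetMin_some h5
          simp only [startAt, Multiset.mem_map, Multiset.mem_filter] at h6 h7
          obtain ⟨⟨u', x'⟩, ⟨⟨h8, h9⟩, h10⟩, h11⟩ := h6
          simp only at h9 h11
          subst h9 h11
          have huy : u ≤ y := hms _ h2 rfl
          have hyx : y < x' := h10.2.1
          have hmin : ∀ Δ ∈ n, Δ.1 = u + 1 → y < Δ.2 → x' ≤ Δ.2 := by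
            intro Δ q1 q2 q3
            exact h7 _ ⟨Δ, ⟨⟨q1, q2⟩, by simp only [Prec]; omega⟩, rfl⟩
          have hne : ((u + 1, x') : Seg) ≠ (u, y) := by
            intro h; simp at h
          have e1 : n = (u, y) ::ₘ (u + 1, x') ::ₘ n' := by
            rw [← hs, Multiset.cons_erase ((Multiset.mem_erase_of_ne hne).mpr h8),
              Multiset.cons_erase h2]
          have gx : ∀ t, GX u n t = GX u n' t + if t < x' then 1 else 0 := by
            intro t
            rw [e1, GX_cons, GX_cons]; simp
          have gy : ∀ t, GY u n t = GY u n' t + if t ≤ y then 1 else 0 := by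
            intro t
            rw [e1, GY_cons, GY_cons]; simp
          have hsub : ∀ Δ ∈ n', Δ ∈ n := by
            intro Δ h; rw [e1]; simp [h]
          have hxw : y < w → x' ≤ w := fun h => hmin _ hw rfl h
          have hHy := hH y
          have hcs : ∀ t, GY u n' t ≤ GY u n' y := by
            intro t
            by_cases ht : y ≤ t
            · exact GY_anti _ _ ht
            · rw [GY_eq_CS (t := y) (fun Δ hΔ h => h4 Δ (hsub _ hΔ) h)]
              exact GY_le_CS _ _ _
          refine ih n' ?_ ?_ (fun Δ hΔ h => hms _ (hsub _ hΔ) h) ?_ ?_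
          · rw [e1] at hk; simp at hk; omega
          · by_cases hx : x' = w
            · subst hx
              have q1 : GX u n' x' < GX u n' y := by
                have := gx y; have := gx x'; have := gy y; have := gy x'
                have := hcs x'
                split_ifs at * <;> omega
              by_contra hcon
              have q2 : GX u n' x' = GX u n' y := by
                refine GX_congr fun Δ hΔ h => ?_
                constructor
                · intro h; omega
                · intro h'
                  have := hmin _ (hsub _ hΔ) h h'
                  rcases this.lt_or_eq with h'' | h''
                  · exact h''
                  · exact absurd (by rw [← h, h'']; exact hΔ) hcon
              omega
            · rw [e1] at hw
              simp only [Multiset.mem_cons, Prod.mk.injEq] at hw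
              rcases hw with h | h | h
              · omega
              · omega
              · exact h
          · have := gx w; have := gy w
            split_ifs at * <;> omega
          · intro t
            have q1 := gx t; have q2 := gy t; have q3 := hH t
            by_cases ht : y < t ∧ t < x'
            · have q4 : GX u n t = GX u n y := by
                refine GX_congr fun Δ hΔ h => ?_
                constructor
                · intro h; omega
                · intro h'
                  have := hmin _ hΔ h h'
                  omega
              have := hcs t; have := gx y; have := gy y
              split_ifs at * <;> omega
            · split_ifs at * <;> omega

theorem Irho_spec {a w : ℤ} {base : Multiset Seg} {n : Multiset Seg}
    (hn : n = base + {(a + 1, w)}) (haw : a ≤ w)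
    (hms : ∀ Δ ∈ n, Δ.1 = a → a ≤ Δ.2) (heq : GX a n w = GY a n w)
    (hH : ∀ t, GY a n t + (if t < w then 1 else 0) ≤ GX a n t) :
    Irho a n = base + {(a, w)} := by
  have h := tus_spec a w n.card n le_rfl (by rw [hn]; simp) hms heq hH
  unfold Irho tusIter
  rw [h]
  simp only [pushSeg, haw, if_true]
  rw [hn, add_comm base, Multiset.singleton_add, Multiset.erase_cons_head]

/-- Relational description of the tail of a downward sequence. -/
inductive DChain (n : Multiset Seg) : Seg → List Seg → Prop
  | nil (p : Seg) : (∀ Δ ∈ n, ¬ Prec Δ p) → DChain n p []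
  | cons (p q : Seg) (L : List Seg) : q ∈ n → Prec q p →
      (∀ Δ ∈ n, Prec Δ p → Δ.1 ≤ q.1) → (∀ Δ ∈ n, Δ.1 = q.1 → q.2 ≤ Δ.2) →
      DChain n q L → DChain n p (q :: L)

theorem DChain.unique {n : Multiset Seg} {p : Seg} {L L' : List Seg}
    (h : DChain n p L) (h' : DChain n p L') : L = L' := by
  induction h generalizing L' with
  | nil p h0 =>
    cases h' with
    | nil => rfl
    | cons _ q L h1 h2 => exact absurd h2 (h0 _ h1)
  | cons p q L h1 h2 h3 h4 h5 ih =>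
    cases h' with
    | nil _ h0 => exact absurd h2 (h0 _ h1)
    | cons _ q' L' k1 k2 k3 k4 k5 =>
      have e1 : q.1 = q'.1 := le_antisymm (k3 _ h1 h2) (h3 _ k1 k2)
      have e2 : q.2 = q'.2 := le_antisymm (h4 _ k1 e1.symm) (k4 _ h1 e1)
      have e : q = q' := Prod.ext e1 e2
      subst e
      rw [ih k5]

/-- Every segment starts by `b+1` and ends at `b` or later. -/
def GR (b : ℤ) (n : Multiset Seg) : Prop := ∀ Δ ∈ n, Δ.1 ≤ b + 1 ∧ b ≤ Δ.2

theorem dsAux_chain {b : ℤ} {n : Multiset Seg} (hn : GR b n) (k : ℕ) : ∀ p : Seg,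
    p.1 ≤ b + 1 → (n.filter fun Δ => Δ.1 < p.1).card ≤ k → DChain n p (dsAux n k p) := by
  induction k with
  | zero =>
    intro p _ h
    have h0 : (n.filter fun Δ => Δ.1 < p.1) = 0 := by simpa using h
    refine DChain.nil p fun Δ hΔ hp => ?_
    have : Δ ∈ (n.filter fun Δ => Δ.1 < p.1) := Multiset.mem_filter.mpr ⟨hΔ, hp.1⟩
    rw [h0] at this
    simp at this
  | succ k ih =>
    intro p hp h
    unfold dsAux dsNext
    cases h1 : msetMax ((n.filter fun Δ => Prec Δ p).map Prod.fst) with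
    | none =>
      simp only
      have h2 := msetMax_none h1
      rw [Multiset.map_eq_zero] at h2
      refine DChain.nil p fun Δ hΔ hp => ?_
      have : Δ ∈ (n.filter fun Δ => Prec Δ p) := Multiset.mem_filter.mpr ⟨hΔ, hp⟩
      rw [h2] at this
      simp at this
    | some aq =>
      simp only
      obtain ⟨h2, h3⟩ := msetMax_some h1
      simp only [Multiset.mem_map, Multiset.mem_filter] at h2 h3
      obtain ⟨Δ0, ⟨h4, h5⟩, h6⟩ := h2
      cases h7 : shortStart n aq with
      | none => exact absurd h6 (shortStart_none h7 _ h4)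
      | some q =>
        simp only
        obtain ⟨k1, k2, k3⟩ := shortStart_some h7
        have k4 := hn _ k1
        have k5 := k3 _ h4 h6
        have hqp : Prec q p := by
          obtain ⟨r1, r2, r3⟩ := h5
          refine ⟨?_, ?_, ?_⟩ <;> omega
        refine DChain.cons p q _ k1 hqp ?_ ?_ (ih q k4.1 ?_)
        · intro Δ r1 r2
          rw [k2]
          exact h3 _ ⟨Δ, ⟨r1, r2⟩, rfl⟩
        · intro Δ r1 r2
          exact k3 _ r1 (by omega)
        · have : (n.filter fun Δ => Δ.1 < q.1).card < (n.filter fun Δ => Δ.1 < p.1).card := by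
            apply Multiset.card_lt_card
            refine lt_of_le_of_ne
              (Multiset.monotone_filter_right _ fun Δ (r : Δ.1 < q.1) => lt_trans r hqp.1) ?_
            intro he
            have : q ∈ (n.filter fun Δ => Δ.1 < p.1) := Multiset.mem_filter.mpr ⟨k1, hqp.1⟩
            rw [← he] at this
            simp at this
          omega

/-- Relational description of the downward sequence. -/
def IsDs (n : Multiset Seg) (p : Seg) (L : List Seg) : Prop :=
  p ∈ n ∧ (∀ Δ ∈ n, Δ.1 ≤ p.1) ∧ (∀ Δ ∈ n, Δ.1 = p.1 → p.2 ≤ Δ.2) ∧ DChain n p L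

theorem dsList_isDs {b : ℤ} {n : Multiset Seg} (hn : GR b n) (h0 : n ≠ 0) :
    ∃ p L, dsList n = p :: L ∧ IsDs n p L := by
  unfold dsList
  cases h1 : msetMax (n.map Prod.fst) with
  | none =>
    have h2 := msetMax_none h1
    rw [Multiset.map_eq_zero] at h2
    exact absurd h2 h0
  | some a1 =>
    obtain ⟨h2, h3⟩ := msetMax_some h1
    simp only [Multiset.mem_map] at h2 h3
    obtain ⟨Δ0, h4, h6⟩ := h2
    simp only
    cases h7 : shortStart n a1 with
    | none => exact absurd h6 (shortStart_none h7 _ h4)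
    | some q =>
      obtain ⟨k1, k2, k3⟩ := shortStart_some h7
      refine ⟨q, dsAux n n.card q, rfl, k1, ?_, ?_, ?_⟩
      · intro Δ r
        rw [k2]
        exact h3 _ ⟨Δ, r, rfl⟩
      · intro Δ r1 r2
        exact k3 _ r1 (by omega)
      · exact dsAux_chain hn _ _ (hn _ k1).1 (Multiset.card_le_card (Multiset.filter_le _ _))

theorem IsDs.unique {n : Multiset Seg} {p p' : Seg} {L L' : List Seg}
    (h : IsDs n p L) (h' : IsDs n p' L') : p :: L = p' :: L' := by
  obtain ⟨h1, h2, h3, h4⟩ := h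
  obtain ⟨k1, k2, k3, k4⟩ := h'
  have e1 : p.1 = p'.1 := le_antisymm (k2 _ h1) (h2 _ k1)
  have e2 : p.2 = p'.2 := le_antisymm (h3 _ k1 e1.symm) (k3 _ h1 e1)
  have e : p = p' := Prod.ext e1 e2
  subst e
  rw [h4.unique k4]

theorem DChain.sorted {n : Multiset Seg} {p : Seg} {L : List Seg} (h : DChain n p L) :
    (p :: L).Pairwise (fun x y => y.1 < x.1) ∧ ∀ Δ ∈ L, Δ ∈ n := by
  induction h with
  | nil p h => simp
  | cons p q L h1 h2 h3 h4 h5 ih =>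
    obtain ⟨i1, i2⟩ := ih
    constructor
    · rw [List.pairwise_cons]
      refine ⟨?_, i1⟩
      intro Δ hΔ
      rcases List.mem_cons.mp hΔ with rfl | h
      · exact h2.1
      · exact lt_trans ((List.pairwise_cons.mp i1).1 _ h) h2.1
    · intro Δ hΔ
      rcases List.mem_cons.mp hΔ with rfl | h
      · exact h1
      · exact i2 _ h

theorem IsDs.le {n : Multiset Seg} {p : Seg} {L : List Seg} (h : IsDs n p L) :
    ((p :: L : List Seg) : Multiset Seg) ≤ n := by
  obtain ⟨h1, h2, h3, h4⟩ := h
  obtain ⟨k1, k2⟩ := h4.sorted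
  have nd : (p :: L).Nodup := k1.imp (fun {x y} hxy he => by subst he; exact lt_irrefl _ hxy)
  rw [Multiset.le_iff_subset (Multiset.coe_nodup.mpr nd)]
  intro Δ hΔ
  rcases List.mem_cons.mp (Multiset.mem_coe.mp hΔ) with rfl | h
  · exact h1
  · exact k2 _ h

/-- Decomposition of the chain with its last element, which has minimal end. -/
theorem DChain.last {b : ℤ} {n : Multiset Seg} (hn : GR b n) {p : Seg} {L : List Seg}
    (h : DChain n p L) (hp : p.1 ≤ b + 1) :
    ∃ I q, p :: L = I ++ [q] ∧ (∀ Δ ∈ I, q.1 < Δ.1) ∧ q.2 ≤ p.2 ∧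
      ∀ Δ ∈ n, Δ.1 < p.1 → q.2 ≤ Δ.2 := by
  induction h with
  | nil p h =>
    refine ⟨[], p, rfl, by simp, le_rfl, ?_⟩
    intro Δ hΔ h1
    by_contra h2
    have := hn _ hΔ
    exact h Δ hΔ ⟨h1, by omega, by omega⟩
  | cons p q L h1 h2 h3 h4 h5 ih =>
    obtain ⟨I, r, e, i1, i2, i3⟩ := ih (hn _ h1).1
    have hrq : r.1 ≤ q.1 := by
      cases I with
      | nil => simp at e; rw [e.1]
      | cons q' I => 
        have : q = q' := by simpa using congrArg List.head? e
        subst this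
        exact (i1 q (by simp)).le
    refine ⟨p :: I, r, by rw [e]; rfl, ?_, ?_, ?_⟩
    · intro Δ hΔ
      rcases List.mem_cons.mp hΔ with rfl | h
      · exact lt_of_le_of_lt hrq h2.1
      · exact i1 _ h
    · have := h2.2.1; omega
    · intro Δ hΔ hlt
      rcases lt_trichotomy Δ.1 q.1 with h | h | h
      · exact i3 _ hΔ h
      · have := h4 _ hΔ h; omega
      · by_contra hc
        have k := hn _ hΔ
        have := h2.2.1
        have := h3 _ hΔ ⟨hlt, by omega, by omega⟩
        omega

/-- Lifting a chain from the part starting at `a+1` or later to the whole. -/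
theorem DChain.lift {a b : ℤ} {n : Multiset Seg} (hn : GR b n) (ha : ∀ Δ ∈ n, a ≤ Δ.1)
    {p : Seg} {L : List Seg}
    (h : DChain (n.filter fun Δ => a + 1 ≤ Δ.1) p L) (hp : p.1 ≤ b + 1) (hp' : a + 1 ≤ p.1)
    {I : List Seg} {q : Seg} (e : p :: L = I ++ [q]) (tail : List Seg)
    (ht : (tail = [] ∧ ∀ Δ ∈ n, Δ.1 = a → q.2 ≤ Δ.2) ∨
      ∃ y, tail = [(a, y)] ∧ (a, y) ∈ n ∧ y < q.2 ∧ ∀ Δ ∈ n, Δ.1 = a → y ≤ Δ.2) :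
    DChain n p (L ++ tail) := by
  induction h generalizing I with
  | nil p h =>
    have hq : I = [] ∧ p = q := by
      cases I with
      | nil => simpa using e
      | cons x I => simp at e
    obtain ⟨rfl, rfl⟩ := hq
    have hN : ∀ Δ ∈ n, Prec Δ p → Δ.1 = a := by
      intro Δ h1 h2
      by_contra h3
      have := ha _ h1
      exact h Δ (Multiset.mem_filter.mpr ⟨h1, by omega⟩) h2
    rcases ht with ⟨rfl, h1⟩ | ⟨y, rfl, h1, h2, h3⟩
    · refine DChain.nil p fun Δ k1 k2 => ?_
      have := h1 _ k1 (hN _ k1 k2)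
      have := k2.2.1
      omega
    · have hy := hn _ h1
      simp only at hy
      refine DChain.cons p (a, y) [] h1 ⟨by simp only; omega, h2, by simp only; omega⟩ ?_ ?_ ?_
      · intro Δ k1 k2
        exact (hN _ k1 k2).le
      · intro Δ k1 k2
        exact h3 _ k1 k2
      · refine DChain.nil _ fun Δ k1 k2 => ?_
        have := ha _ k1
        have := k2.1
        simp only at this
        omega
  | cons p r L h1 h2 h3 h4 h5 ih =>
    have h1' := Multiset.mem_filter.mp h1
    cases I with
    | nil => simp at e
    | cons x I =>
      have e' : r :: L = I ++ [q] := by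
        have := congrArg List.tail e
        simpa using this
      refine DChain.cons p r _ h1'.1 h2 ?_ ?_ (ih (hn _ h1'.1).1 h1'.2 e')
      · intro Δ k1 k2
        by_cases hΔ : a + 1 ≤ Δ.1
        · exact h3 _ (Multiset.mem_filter.mpr ⟨k1, hΔ⟩) k2
        · omega
      · intro Δ k1 k2
        exact h4 _ (Multiset.mem_filter.mpr ⟨k1, by omega⟩) k2

/-- The comparison of the first rows. -/
theorem row_spec {a b : ℤ} {n : Multiset Seg} (hn : GR b n) (ha : ∀ Δ ∈ n, a ≤ Δ.1)
    (h0 : (n.filter fun Δ => a + 1 ≤ Δ.1) ≠ 0) :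
    ∃ I q tail, dsList (n.filter fun Δ => a + 1 ≤ Δ.1) = I ++ [q] ∧
      dsList n = I ++ [q] ++ tail ∧ (∀ Δ ∈ I, a + 2 ≤ Δ.1) ∧ a + 1 ≤ q.1 ∧
      ((dsList n : List Seg) : Multiset Seg) ≤ n ∧
      (∀ Δ ∈ n, a + 1 ≤ Δ.1 → q.2 ≤ Δ.2) ∧
      ((tail = [] ∧ ∀ Δ ∈ n, Δ.1 = a → q.2 ≤ Δ.2) ∨
        ∃ y, tail = [(a, y)] ∧ y < q.2 ∧ ∀ Δ ∈ n, Δ.1 = a → y ≤ Δ.2) := by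
  have hn' : GR b (n.filter fun Δ => a + 1 ≤ Δ.1) :=
    fun Δ hΔ => hn _ (Multiset.mem_filter.mp hΔ).1
  obtain ⟨p, L, e, hd⟩ := dsList_isDs hn' h0
  obtain ⟨h1, h2, h3, h4⟩ := id hd
  have h1' := Multiset.mem_filter.mp h1
  obtain ⟨I, q, e', i1, i2, i3⟩ := h4.last hn' (hn' _ h1).1
  have hq : q ∈ n.filter fun Δ => a + 1 ≤ Δ.1 := by
    apply Multiset.subset_of_le hd.le
    rw [e']; simp
  have hq' := Multiset.mem_filter.mp hq
  obtain ⟨tail, ht⟩ : ∃ tail : List Seg, (tail = [] ∧ ∀ Δ ∈ n, Δ.1 = a → q.2 ≤ Δ.2) ∨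
      ∃ y, tail = [(a, y)] ∧ (a, y) ∈ n ∧ y < q.2 ∧ ∀ Δ ∈ n, Δ.1 = a → y ≤ Δ.2 := by
    cases hs : shortStart n a with
    | none => exact ⟨[], Or.inl ⟨rfl, fun Δ k1 k2 => absurd k2 (shortStart_none hs _ k1)⟩⟩
    | some Δ =>
      obtain ⟨u, y⟩ := Δ
      obtain ⟨k1, k2, k3⟩ := shortStart_some hs
      simp only at k2 k3
      subst k2
      by_cases hy : y < q.2
      · exact ⟨_, Or.inr ⟨y, rfl, k1, hy, k3⟩⟩
      · refine ⟨[], Or.inl ⟨rfl, fun Δ r1 r2 => ?_⟩⟩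
        have := k3 _ r1 r2
        omega
  have hc := h4.lift hn ha (hn' _ h1).1 h1'.2 e' tail ht
  have hd2 : IsDs n p (L ++ tail) := by
    refine ⟨h1'.1, ?_, ?_, hc⟩
    · intro Δ k
      by_cases hΔ : a + 1 ≤ Δ.1
      · exact h2 _ (Multiset.mem_filter.mpr ⟨k, hΔ⟩)
      · omega
    · intro Δ k1 k2
      exact h3 _ (Multiset.mem_filter.mpr ⟨k1, by omega⟩) k2
  have hne : n ≠ 0 := by
    rintro rfl
    simp at h1
  obtain ⟨p2, L2, e2, hd3⟩ := dsList_isDs hn hne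
  have e3 : dsList n = I ++ [q] ++ tail := by
    rw [e2, hd3.unique hd2, ← List.cons_append, e']
  refine ⟨I, q, tail, by rw [e, e'], e3, ?_, hq'.2, ?_, ?_, ?_⟩
  · intro Δ hΔ
    have := i1 _ hΔ
    omega
  · rw [e2]; exact hd3.le
  · intro Δ k1 k2
    have k3 : Δ ∈ n.filter fun Δ => a + 1 ≤ Δ.1 := Multiset.mem_filter.mpr ⟨k1, k2⟩
    rcases (h2 _ k3).lt_or_eq with h | h
    · exact i3 _ k3 h
    · have := h3 _ k3 h
      omega
  · rcases ht with h | ⟨y, k1, k2, k3, k4⟩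
    · exact Or.inl h
    · exact Or.inr ⟨y, k1, k3, k4⟩

theorem findRowI_shift (a : ℤ) (q : Seg) (pt : ℤ) (hpt : a + 1 ≤ pt) (y : ℤ) :
    ∀ I : List Seg, findRowI a (I ++ [q]) pt = findRowI (a + 1) (I ++ [q]) pt ∧
      findRowI a (I ++ [q] ++ [(a, y)]) pt = findRowI (a + 1) (I ++ [q]) pt
  | [] => by
    have h1 : a ≤ pt := by omega
    have h2 : ¬ pt ≤ a - 1 := by omega
    simp [findRowI, hpt, h1, h2]
  | [x] => by
    have ih := findRowI_shift a q pt hpt y []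
    simp only [List.nil_append, List.cons_append] at ih ⊢
    unfold findRowI
    rw [ih.1, ih.2]
    simp
  | x :: x' :: I => by
    have ih := findRowI_shift a q pt hpt y (x' :: I)
    simp only [List.cons_append] at ih ⊢
    unfold findRowI
    rw [ih.1, ih.2]
    simp

theorem findRowI_tail (a : ℤ) (q : Seg) (hq : a + 1 ≤ q.1) (y : ℤ) :
    ∀ I : List Seg, (∀ Δ ∈ I, a + 2 ≤ Δ.1) → findRowI a (I ++ [q] ++ [(a, y)]) a = none
  | [], _ => by
    have h1 : ¬ a ≤ a - 1 := by omega
    have h2 : ¬ a + 1 ≤ a := by omega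
    simp [findRowI]
  | [x], h => by
    have ih := findRowI_tail a q hq y [] (by simp)
    have h2 : ¬ q.1 + 1 ≤ a := by omega
    simp only [List.nil_append, List.cons_append] at ih ⊢
    unfold findRowI
    rw [ih]
    simp [h2]
  | x :: x' :: I, h => by
    have ih := findRowI_tail a q hq y (x' :: I) (fun Δ hΔ => h Δ (List.mem_cons_of_mem _ hΔ))
    have h2 : ¬ x'.1 + 1 ≤ a := by have := h x' (by simp); omega
    simp only [List.cons_append] at ih ⊢
    unfold findRowI
    rw [ih]
    simp [h2]

theorem findRowI_last (a : ℤ) (q : Seg) (hq : a + 1 ≤ q.1) :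
    ∀ I : List Seg, (∀ Δ ∈ I, a + 1 ≤ Δ.1) → findRowI a (I ++ [q]) a = some q
  | [], _ => by
    have h1 : a ≤ q.1 - 1 := by omega
    simp [findRowI, h1]
  | [x], h => by
    have ih := findRowI_last a q hq [] (by simp)
    have h2 : ¬ q.1 + 1 ≤ a := by omega
    simp only [List.nil_append, List.cons_append] at ih ⊢
    unfold findRowI
    rw [ih]
    simp [h2]
  | x :: x' :: I, h => by
    have ih := findRowI_last a q hq (x' :: I) (fun Δ hΔ => h Δ (List.mem_cons_of_mem _ hΔ))
    have h2 : ¬ x'.1 + 1 ≤ a := by have := h x' (by simp); omega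
    simp only [List.cons_append] at ih ⊢
    unfold findRowI
    rw [ih]
    simp [h2]

theorem findRowI_block (a : ℤ) (q : Seg) (hq : q.1 = a) :
    ∀ I : List Seg, (∀ Δ ∈ I, a ≤ Δ.1) → findRowI a (I ++ [q]) a = none
  | [], _ => by
    have h1 : ¬ a ≤ q.1 - 1 := by omega
    simp [findRowI, h1]
  | [x], h => by
    have ih := findRowI_block a q hq [] (by simp)
    have h2 : ¬ q.1 + 1 ≤ a := by omega
    simp only [List.nil_append, List.cons_append] at ih ⊢
    unfold findRowI
    rw [ih]
    simp [h2]
  | x :: x' :: I, h => by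
    have ih := findRowI_block a q hq (x' :: I) (fun Δ hΔ => h Δ (List.mem_cons_of_mem _ hΔ))
    have h2 : ¬ x'.1 + 1 ≤ a := by have := h x' (by simp); omega
    simp only [List.cons_append] at ih ⊢
    unfold findRowI
    rw [ih]
    simp [h2]

theorem findRowI_some (a pt : ℤ) (Δ : Seg) :
    ∀ L : List Seg, findRowI a L pt = some Δ → Δ ∈ L ∧ pt < Δ.1
  | [], h => by simp [findRowI] at h
  | [x], h => by
    simp only [findRowI, Bool.and_eq_true, decide_eq_true_eq] at h
    split_ifs at h with h1
    simp only [Option.some.injEq] at h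
    subst h
    exact ⟨by simp, by omega⟩
  | x :: x' :: I, h => by
    rw [findRowI] at h
    simp only [Bool.and_eq_true, decide_eq_true_eq] at h
    split_ifs at h with h1
    · simp only [Option.some.injEq] at h
      subst h
      exact ⟨by simp, by omega⟩
    · have ih := findRowI_some a pt Δ (x' :: I) h
      exact ⟨List.mem_cons_of_mem _ ih.1, ih.2⟩

/-- The current point after a selection. -/
def endPt (s : List (Seg × ℤ)) (pt : ℤ) : ℤ :=
  match s.getLast? with
  | none => pt
  | some (Δ, _) => Δ.1

/-- The selection extension by one row. -/
def selExt (o : Option Seg) (pt : ℤ) : List (Seg × ℤ) :=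
  match o with
  | none => []
  | some Δ => [(Δ, pt)]

theorem endPt_nil (pt : ℤ) : endPt [] pt = pt := rfl

theorem endPt_cons (x : Seg × ℤ) (s : List (Seg × ℤ)) (pt : ℤ) :
    endPt (x :: s) pt = endPt s x.1.1 := by
  cases s with
  | nil => rfl
  | cons y s =>
    unfold endPt
    rw [List.getLast?_cons_cons]
    cases h : (y :: s).getLast? with
    | none => simp at h
    | some z => rfl

theorem selAuxI_cons (a : ℤ) (row : List Seg) (R : List (List Seg)) (n : ℕ) : ∀ pt : ℤ,
    selAuxI a (row :: R) (n + 1) pt = selAuxI a R n pt ++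
      selExt (findRowI a row (endPt (selAuxI a R n pt) pt)) (endPt (selAuxI a R n pt) pt) := by
  induction n with
  | zero =>
    intro pt
    simp only [selAuxI, endPt_nil, List.nil_append, List.getD_cons_zero]
    cases findRowI a row pt <;> rfl
  | succ n ih =>
    intro pt
    rw [selAuxI]
    simp only [List.getD_cons_succ]
    conv_rhs => rw [selAuxI]
    cases h : findRowI a (R.getD n []) pt with
    | none => simp only; exact ih pt
    | some Δ =>
      simp only
      rw [ih, endPt_cons]
      rfl

/-- The later selected segments all lie above `a+2`. -/
def TG (a : ℤ) (T : List (Seg × ℤ)) : Prop := ∀ p ∈ T, a + 2 ≤ p.1.1 ∧ a + 2 ≤ p.2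

theorem endPt_ge {a : ℤ} {T : List (Seg × ℤ)} (hT : TG a T) (pt : ℤ) (hpt : a + 2 ≤ pt) :
    a + 2 ≤ endPt T pt := by
  induction T generalizing pt with
  | nil => exact hpt
  | cons x T ih =>
    rw [endPt_cons]
    exact ih (fun p hp => hT p (List.mem_cons_of_mem _ hp)) _ (hT x (by simp)).1

theorem selExt_TG {a a' pt : ℤ} {L : List Seg} (hpt : a + 2 ≤ pt) :
    TG a (selExt (findRowI a' L pt) pt) := by
  intro p hp
  cases h : findRowI a' L pt with
  | none => rw [h] at hp; simp [selExt] at hp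
  | some Δ =>
    rw [h] at hp
    simp only [selExt, List.mem_singleton] at hp
    subst hp
    have := (findRowI_some _ _ _ _ h).2
    simp only
    omega

theorem selExt_le {a pt : ℤ} {L : List Seg} :
    (((selExt (findRowI a L pt) pt).map Prod.fst : List Seg) : Multiset Seg) ≤ L := by
  cases h : findRowI a L pt with
  | none => simp [selExt]
  | some Δ =>
    have := (findRowI_some _ _ _ _ h).1
    simpa [selExt] using this

/-- The comparison of the two selections. -/
def Concl (a b : ℤ) (N : Multiset Seg) (S S' : List (Seg × ℤ)) : Prop :=
  ((S.map Prod.fst : List Seg) : Multiset Seg) ≤ N ∧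
  ((S = [] ∧ S' = [] ∧ CS (a + 1) N = CS a N) ∨
   (∃ Δ T, S = (Δ, a) :: T ∧ S' = (Δ, a + 1) :: T ∧ a + 2 ≤ Δ.1 ∧ TG a T ∧
      GX a N Δ.2 = GY a N Δ.2) ∨
   (∃ x, S = ((a + 1, x), a) :: S' ∧ GX a N x = GY a N x ∧
      ((S' = [] ∧ ∀ t, GY a N t + (if t < x then 1 else 0) ≤ GX a N t + if t < b then 1 else 0) ∨
       (∃ Δ T, S' = (Δ, a + 1) :: T ∧ a + 2 ≤ Δ.1 ∧ TG a T ∧ Δ.2 ≤ x ∧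
        ∀ t, GY a N t + (if t < x then 1 else 0) ≤ GX a N t + if t < Δ.2 then 1 else 0))))

theorem dsDecomp_zero (k : ℕ) : dsDecomp k 0 = [] := by
  cases k <;> simp [dsDecomp]

theorem TG_append {a : ℤ} {T T' : List (Seg × ℤ)} (h : TG a T) (h' : TG a T') :
    TG a (T ++ T') := by
  intro p hp
  rcases List.mem_append.mp hp with hp | hp
  · exact h p hp
  · exact h' p hp

theorem step_concl {a b : ℤ} {N N1 : Multiset Seg} {I tail : List Seg} {q : Seg}
    {S1 S1' : List (Seg × ℤ)}
    (hN : N = N1 + ((I ++ [q] ++ tail : List Seg) : Multiset Seg))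
    (hgr : GR b N) (hI : ∀ Δ ∈ I, a + 2 ≤ Δ.1) (hq : a + 1 ≤ q.1)
    (hmin : ∀ Δ ∈ N, a + 1 ≤ Δ.1 → q.2 ≤ Δ.2)
    (ht : (tail = [] ∧ ∀ Δ ∈ N, Δ.1 = a → q.2 ≤ Δ.2) ∨
        ∃ y, tail = [(a, y)] ∧ y < q.2 ∧ ∀ Δ ∈ N, Δ.1 = a → y ≤ Δ.2)
    (hH : Hall a N) :
    Hall a N1 ∧ (Concl a b N1 S1 S1' →
      Concl a b N
        (S1 ++ selExt (findRowI a (I ++ [q] ++ tail) (endPt S1 a)) (endPt S1 a))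
        (S1' ++ selExt (findRowI (a + 1) (I ++ [q]) (endPt S1' (a + 1))) (endPt S1' (a + 1)))) := by
  have hsub : ∀ Δ ∈ N1, Δ ∈ N := by
    intro Δ h; rw [hN]; exact Multiset.mem_add.mpr (Or.inl h)
  have hqN : q ∈ N := by rw [hN]; simp
  have hbq := (hgr _ hqN).2
  have hIX : ∀ t, GX a (I : Multiset Seg) t = 0 := fun t => GX_zero' fun Δ hΔ h => by
    have := hI Δ (Multiset.mem_coe.mp hΔ); omega
  have hIY : ∀ t, GY a (I : Multiset Seg) t = 0 := fun t => GY_zero' fun Δ hΔ h => by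
    have := hI Δ (Multiset.mem_coe.mp hΔ); omega
  have hICX : CS (a + 1) (I : Multiset Seg) = 0 := CS_zero' fun Δ hΔ h => by
    have := hI Δ (Multiset.mem_coe.mp hΔ); omega
  have hICY : CS a (I : Multiset Seg) = 0 := CS_zero' fun Δ hΔ h => by
    have := hI Δ (Multiset.mem_coe.mp hΔ); omega
  have hN' : N = N1 + ((I : Multiset Seg) + (q ::ₘ (tail : Multiset Seg))) := by
    rw [hN, ← Multiset.coe_add, ← Multiset.coe_add, add_assoc]
    rfl
  have hqa : q.1 ≠ a := by omega
  have gx0 : ∀ t, GX a N t = GX a N1 t + ((GX a (tail : Multiset Seg) t) +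
      if q.1 = a + 1 ∧ t < q.2 then 1 else 0) := by
    intro t
    conv_lhs => rw [hN', GX_add, GX_add, GX_cons, hIX, zero_add]
  have gy0 : ∀ t, GY a N t = GY a N1 t + GY a (tail : Multiset Seg) t := by
    intro t
    conv_lhs => rw [hN', GY_add, GY_add, GY_cons, hIY, zero_add]
    simp [hqa]
  have cx0 : CS (a + 1) N = CS (a + 1) N1 + ((CS (a + 1) (tail : Multiset Seg)) +
      if q.1 = a + 1 then 1 else 0) := by
    conv_lhs => rw [hN', CS_add, CS_add, CS_cons, hICX, zero_add]
  have cy0 : CS a N = CS a N1 + CS a (tail : Multiset Seg) := by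
    conv_lhs => rw [hN', CS_add, CS_add, CS_cons, hICY, zero_add]
    simp [hqa]
  have lx : ∀ t, GX a N t ≤ CS (a + 1) N := fun t => GX_le_CS _ _ _
  have lx1 : ∀ t, GX a N1 t ≤ CS (a + 1) N1 := fun t => GX_le_CS _ _ _
  have ly : ∀ t, GY a N t ≤ CS a N := fun t => GY_le_CS _ _ _
  have ly1 : ∀ t, GY a N1 t ≤ CS a N1 := fun t => GY_le_CS _ _ _
  have ex1 : ∀ t, t < q.2 → GX a N1 t = CS (a + 1) N1 := fun t h =>
    GX_eq_CS fun Δ hΔ h' => by have := hmin _ (hsub _ hΔ) (by omega); omega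
  have hmw : ∀ Δ ∈ N1, a + 1 ≤ Δ.1 → q.2 ≤ Δ.2 := fun Δ h h' => hmin _ (hsub _ h) h'
  have hsel : ∀ pt, a + 1 ≤ pt →
      findRowI a (I ++ [q] ++ tail) pt = findRowI (a + 1) (I ++ [q]) pt := by
    intro pt hpt
    rcases ht with ⟨rfl, -⟩ | ⟨y, rfl, -⟩
    · rw [List.append_nil]; exact (findRowI_shift a q pt hpt 0 I).1
    · exact (findRowI_shift a q pt hpt y I).2
  have hle : Concl a b N1 S1 S1' → ((((S1 ++ selExt (findRowI a (I ++ [q] ++ tail) (endPt S1 a))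
      (endPt S1 a)).map Prod.fst : List Seg)) : Multiset Seg) ≤ N := by
    intro h
    rw [List.map_append, ← Multiset.coe_add]
    conv_rhs => rw [hN]
    exact add_le_add h.1 selExt_le
  have hI1 : ∀ Δ ∈ I, a + 1 ≤ Δ.1 := fun Δ h => by have := hI Δ h; omega
  have hI2 : ∀ Δ ∈ I, a + 1 + 1 ≤ Δ.1 := fun Δ h => by have := hI Δ h; omega
  have blockx : q.1 = a + 1 → findRowI (a + 1) (I ++ [q]) (a + 1) = none :=
    fun h => findRowI_block (a + 1) q h I hI1
  have takez : a + 2 ≤ q.1 → findRowI (a + 1) (I ++ [q]) (a + 1) = some q :=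
    fun h => findRowI_last (a + 1) q (by omega) I hI2
  -- counting facts, uniform in the two shapes of the tail
  obtain ⟨c, fy, gxt, gyt, cyt, hfy, hfc, hc1⟩ : ∃ (c : ℕ) (fy : ℤ → ℕ),
      (∀ t, GX a (tail : Multiset Seg) t = 0) ∧ (∀ t, GY a (tail : Multiset Seg) t = fy t) ∧
      CS a (tail : Multiset Seg) = c ∧ (∀ t, q.2 ≤ t → fy t = 0) ∧
      (∀ t, fy t ≤ c ∧ (fy t < c → GY a N1 t ≤ GX a N1 t)) ∧ c ≤ 1 := by
    rcases ht with ⟨rfl, -⟩ | ⟨y, rfl, hy, hy'⟩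
    · exact ⟨0, fun _ => 0, fun t => rfl, fun t => rfl, rfl, fun _ _ => rfl, by simp, by simp⟩
    · refine ⟨1, fun t => if t ≤ y then 1 else 0, ?_, ?_, ?_, ?_, ?_, le_rfl⟩
      · intro t
        exact GX_zero' fun Δ hΔ h => by
          simp at hΔ; subst hΔ; simp at h
      · intro t
        rw [← Multiset.cons_coe, GY_cons]
        simp [GY]
      · rw [← Multiset.cons_coe, CS_cons]
        simp [CS]
      · intro t h
        simp only
        rw [if_neg (by omega)]
      · intro t
        refine ⟨by simp only; split_ifs <;> omega, fun h => ?_⟩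
        have h1 := hH t
        have h2 := hH y
        have g1 := gx0 t; have g2 := gy0 t
        have g4 := gy0 y
        have z1 : GX a (([(a, y)] : List Seg) : Multiset Seg) t = 0 :=
          GX_zero' fun Δ hΔ h => by simp at hΔ; subst hΔ; simp at h
        have z2 : GY a (([(a, y)] : List Seg) : Multiset Seg) y = 1 := by
          rw [← Multiset.cons_coe, GY_cons]; simp [GY]
        have z4 : CS (a + 1) (([(a, y)] : List Seg) : Multiset Seg) = 0 :=
          CS_zero' fun Δ hΔ h => by simp at hΔ; subst hΔ; simp at h
        have e1 : GY a N1 y = CS a N1 := GY_eq_CS fun Δ hΔ h => hy' _ (hsub _ hΔ) h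
        have e2 := ly1 t
        have e3 := lx y
        by_cases htq : t < q.2
        · have e4 := ex1 t htq
          split_ifs at * <;> omega
        · rw [if_neg (by omega)] at g1
          omega
  have cxt : CS (a + 1) (tail : Multiset Seg) = 0 := by
    rcases ht with ⟨rfl, -⟩ | ⟨y, rfl, hy, hy'⟩
    · rfl
    · exact CS_zero' fun Δ hΔ h => by simp at hΔ; subst hΔ; simp at h
  have gx : ∀ t, GX a N t = GX a N1 t + if q.1 = a + 1 ∧ t < q.2 then 1 else 0 := by
    intro t; rw [gx0, gxt, zero_add]
  have gy : ∀ t, GY a N t = GY a N1 t + fy t := by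
    intro t; rw [gy0, gyt]
  rw [cxt, zero_add] at cx0
  rw [cyt] at cy0
  have ey0 : c = 0 → ∀ t, t ≤ q.2 → GY a N1 t = CS a N1 := by
    intro h t htq
    rcases ht with ⟨rfl, h'⟩ | ⟨y, rfl, hy, hy'⟩
    · exact GY_eq_CS fun Δ hΔ h'' => by have := h' _ (hsub _ hΔ) h''; omega
    · rw [← cyt] at h
      rw [← Multiset.cons_coe, CS_cons] at h
      simp at h
  have htail0 : c = 0 → tail = [] := by
    intro h
    rcases ht with ⟨rfl, h'⟩ | ⟨y, rfl, hy, hy'⟩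
    · rfl
    · rw [← cyt] at h
      rw [← Multiset.cons_coe, CS_cons] at h
      simp at h
  have htail1 : c = 1 → ∃ y, tail = [(a, y)] := by
    intro h
    rcases ht with ⟨rfl, h'⟩ | ⟨y, rfl, hy, hy'⟩
    · rw [← cyt] at h
      simp [CS] at h
    · exact ⟨y, rfl⟩
  have hall1 : Hall a N1 := by
    intro t
    have h1 := hH t; have h2 := hH q.2
    have g1 := gx t; have g2 := gy t; have g3 := gx q.2; have g4 := gy q.2
    have f1 := hfc t
    by_cases hft : fy t < c
    · exact f1.2 hft
    · by_cases hc : c = 0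
      · have e1 := ey0 hc q.2 le_rfl
        have e2 := lx1 q.2
        have e3 := ly1 t
        rw [if_neg (by omega)] at g3
        by_cases htq : t < q.2
        · have := ex1 t htq; omega
        · rw [if_neg (by omega)] at g1; omega
      · have : fy t = 1 := by omega
        split_ifs at g1 <;> omega
  refine ⟨hall1, fun hC => ⟨hle hC, ?_⟩⟩
  -- The Hall condition with an exchanged pair, after removing the row
  have exch : ∀ w w' : ℤ, q.2 ≤ w → (q.1 = a + 1 ∨ q.2 ≤ w') →
      (∀ t, GY a N1 t + (if t < w then 1 else 0) ≤ GX a N1 t + if t < w' then 1 else 0) →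
      ∀ t, GY a N t + (if t < w then 1 else 0) ≤ GX a N t + if t < w' then 1 else 0 := by
    intro w w' hw hw' h t
    have h0 := h t
    have h1 := hH t
    have g1 := gx t; have g2 := gy t; have f1 := hfc t; have f2 := hfy t
    by_cases hf0 : fy t = 0
    · omega
    · have htq : t < q.2 := by
        by_contra hcon
        exact hf0 (hfy t (by omega))
      have e1 := ex1 t htq
      rcases hw' with hw' | hw'
      · rw [if_pos ⟨hw', htq⟩] at g1
        omega
      · rw [if_pos (show t < w' by omega), if_pos (show t < w by omega)]
        omega
  have eqw : ∀ w, q.2 ≤ w → GX a N1 w = GY a N1 w → GX a N w = GY a N w := by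
    intro w hw h
    have g1 := gx w; have g2 := gy w; have f2 := hfy w hw
    rw [if_neg (by omega)] at g1
    omega
  obtain ⟨hC1, hC2⟩ := hC
  rcases hC2 with ⟨rfl, rfl, hcc⟩ | ⟨Δ, T, rfl, rfl, hΔ, hT, heq⟩ | ⟨x, rfl, heq, hA⟩
  · simp only [endPt_nil, List.nil_append]
    by_cases hx : q.1 = a + 1
    · rw [blockx hx]
      by_cases hc : c = 0
      · -- only x
        rw [htail0 hc, List.append_nil, findRowI_last a q hq I hI1]
        refine Or.inr (Or.inr ⟨q.2, ?_, ?_, Or.inl ⟨rfl, ?_⟩⟩)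
        · simp only [selExt]
          rw [← hx]
        · have g1 := gx q.2; have g2 := gy q.2; have f2 := hfy q.2 le_rfl
          rw [if_neg (by omega)] at g1
          have e1 := ey0 hc q.2 le_rfl
          have e2 := lx1 q.2
          have := hall1 q.2
          omega
        · intro t
          have g1 := gx t; have g2 := gy t; have f1 := hfc t
          have := hall1 t
          split_ifs at * <;> omega
      · -- both
        obtain ⟨y, rfl⟩ := htail1 (by omega)
        rw [findRowI_tail a q hq y I hI]
        refine Or.inl ⟨rfl, rfl, ?_⟩
        rw [if_pos hx] at cx0
        omega
    · rw [takez (by omega)]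
      rw [if_neg hx] at cx0
      by_cases hc : c = 0
      · rw [htail0 hc, List.append_nil, findRowI_last a q hq I hI1]
        refine Or.inr (Or.inl ⟨q, [], rfl, rfl, by omega, fun p hp => by simp at hp, ?_⟩)
        have g1 := gx q.2; have g2 := gy q.2; have f2 := hfy q.2 le_rfl
        rw [if_neg (by omega)] at g1
        have e1 := ey0 hc q.2 le_rfl
        have e2 := lx1 q.2
        have := hall1 q.2
        omega
      · exfalso
        have h1 := hH b
        have e1 : GY a N b = CS a N := GY_eq_CS fun Δ hΔ h => (hgr _ hΔ).2
        have := lx b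
        omega
  · -- case B
    have hΔN : Δ ∈ N1 := by
      apply Multiset.subset_of_le hC1
      simp
    have hqΔ := hmw _ hΔN (by omega)
    simp only [endPt_cons]
    have hpt := endPt_ge hT Δ.1 hΔ
    rw [hsel _ (by omega)]
    refine Or.inr (Or.inl ⟨Δ, T ++ selExt (findRowI (a + 1) (I ++ [q]) (endPt T Δ.1))
      (endPt T Δ.1), rfl, rfl, hΔ, TG_append hT (selExt_TG hpt), eqw _ hqΔ heq⟩)
  · -- case A
    have hxN : ((a + 1, x) : Seg) ∈ N1 := by
      apply Multiset.subset_of_le hC1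
      simp
    have hqx := hmw _ hxN le_rfl
    simp only at hqx
    rw [endPt_cons]
    simp only
    rcases hA with ⟨rfl, hA⟩ | ⟨Δ, T, rfl, hΔ, hT, hΔx, hA⟩
    · simp only [endPt_nil, List.nil_append]
      rw [hsel _ le_rfl]
      refine Or.inr (Or.inr ⟨x, rfl, eqw _ hqx heq, ?_⟩)
      by_cases hx : q.1 = a + 1
      · rw [blockx hx]
        exact Or.inl ⟨rfl, exch x b hqx (Or.inl hx) hA⟩
      · rw [takez (by omega)]
        refine Or.inr ⟨q, [], rfl, by omega, fun p hp => by simp at hp, hqx, ?_⟩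
        refine exch x q.2 hqx (Or.inr le_rfl) fun t => ?_
        have := hA t
        split_ifs at * <;> omega
    · have hΔN : Δ ∈ N1 := by
        apply Multiset.subset_of_le hC1
        simp
      have hqΔ := hmw _ hΔN (by omega)
      simp only [endPt_cons]
      have hpt := endPt_ge hT Δ.1 hΔ
      rw [hsel _ (by omega)]
      refine Or.inr (Or.inr ⟨x, rfl, eqw _ hqx heq, Or.inr ⟨Δ,
        T ++ selExt (findRowI (a + 1) (I ++ [q]) (endPt T Δ.1))
        (endPt T Δ.1), rfl, hΔ, TG_append hT (selExt_TG hpt), hΔx, ?_⟩⟩)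
      exact exch x Δ.2 hqx (Or.inr hqΔ) hA

theorem main_concl (a b : ℤ) (k : ℕ) : ∀ (N : Multiset Seg) (k' : ℕ), N.card ≤ k →
    (N.filter fun Δ => a + 1 ≤ Δ.1).card ≤ k' → GR b N → (∀ Δ ∈ N, a ≤ Δ.1) → Hall a N →
    Concl a b N (selAuxI a (dsDecomp k N) (dsDecomp k N).length a)
      (selAuxI (a + 1) (dsDecomp k' (N.filter fun Δ => a + 1 ≤ Δ.1))
        (dsDecomp k' (N.filter fun Δ => a + 1 ≤ Δ.1)).length (a + 1)) := by
  induction k with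
  | zero =>
    intro N k' h _ _ _ _
    have : N = 0 := by simpa using h
    subst this
    simp only [Multiset.filter_zero, dsDecomp_zero]
    exact ⟨by simp [selAuxI], Or.inl ⟨rfl, rfl, by simp [CS]⟩⟩
  | succ k ih =>
    intro N k' hk hk' hgr ha hH
    by_cases hN0 : N = 0
    · subst hN0
      simp only [Multiset.filter_zero, dsDecomp_zero]
      exact ⟨by simp [selAuxI], Or.inl ⟨rfl, rfl, by simp [CS]⟩⟩
    have h0 : (N.filter fun Δ => a + 1 ≤ Δ.1) ≠ 0 := by
      intro h0
      rw [Multiset.filter_eq_nil] at h0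
      apply hN0
      refine Multiset.eq_zero_of_forall_notMem fun Δ hΔ => ?_
      have h1 := h0 _ hΔ
      have h2 := ha _ hΔ
      have h3 : 0 < GY a N b := Multiset.countP_pos.mpr ⟨Δ, hΔ, by omega, (hgr _ hΔ).2⟩
      have h4 : GX a N b = 0 := GX_zero' fun Δ hΔ h => by
        have := h0 _ hΔ; omega
      have := hH b
      omega
    cases k' with
    | zero => exact absurd (by simpa using hk') h0
    | succ k' =>
      obtain ⟨I, q, tail, e1, e2, hI, hq, hle, hmin, ht⟩ := row_spec hgr ha h0
      set N1 := N - ((dsList N : List Seg) : Multiset Seg) with hN1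
      have hN : N = N1 + ((I ++ [q] ++ tail : List Seg) : Multiset Seg) := by
        rw [← e2, hN1, tsub_add_cancel_of_le hle]
      have hN1' : (N.filter fun Δ => a + 1 ≤ Δ.1) -
          ((dsList (N.filter fun Δ => a + 1 ≤ Δ.1) : List Seg) : Multiset Seg) =
          N1.filter fun Δ => a + 1 ≤ Δ.1 := by
        have f1 : ((I ++ [q] ++ tail : List Seg) : Multiset Seg).filter (fun Δ => a + 1 ≤ Δ.1) =
            ((I ++ [q] : List Seg) : Multiset Seg) := by
          rw [← Multiset.coe_add, Multiset.filter_add]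
          have f2 : (tail : Multiset Seg).filter (fun Δ => a + 1 ≤ Δ.1) = 0 := by
            rw [Multiset.filter_eq_nil]
            intro Δ hΔ
            rcases ht with ⟨rfl, -⟩ | ⟨y, rfl, -⟩
            · simp at hΔ
            · simp at hΔ; subst hΔ; simp
          rw [f2, add_zero, Multiset.filter_eq_self]
          intro Δ hΔ
          rcases List.mem_append.mp (Multiset.mem_coe.mp hΔ) with h | h
          · have := hI _ h; omega
          · simp at h; subst h; exact hq
        rw [e1]
        conv_lhs => rw [hN, Multiset.filter_add, f1]
        exact add_tsub_cancel_right _ _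
      have hsub : ∀ Δ ∈ N1, Δ ∈ N := by
        intro Δ h; rw [hN]; exact Multiset.mem_add.mpr (Or.inl h)
      have hcard : N1.card ≤ k := by
        rw [hN] at hk
        simp at hk
        omega
      have hcard' : (N1.filter fun Δ => a + 1 ≤ Δ.1).card ≤ k' := by
        rw [hN, Multiset.filter_add, ← Multiset.coe_add, ← Multiset.coe_add, Multiset.filter_add,
          Multiset.filter_add] at hk'
        have : (((([q] : List Seg) : Multiset Seg)).filter fun Δ => a + 1 ≤ Δ.1).card = 1 := by
          rw [Multiset.filter_eq_self.mpr]
          · simp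
          · intro Δ h; simp at h; subst h; exact hq
        simp only [Multiset.card_add, this] at hk'
        omega
      have st := fun S1 S1' => step_concl (S1 := S1) (S1' := S1') hN hgr hI hq hmin ht hH
      have hH1 := (st [] []).1
      have ih1 := ih N1 k' hcard hcard' (fun Δ h => hgr _ (hsub _ h)) (fun Δ h => ha _ (hsub _ h)) hH1
      have fin := (st _ _).2 ih1
      have d1 : dsDecomp (k + 1) N = (I ++ [q] ++ tail) :: dsDecomp k N1 := by
        rw [dsDecomp, if_neg hN0, ← hN1, e2]
      have d2 : dsDecomp (k' + 1) (N.filter fun Δ => a + 1 ≤ Δ.1) =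
          (I ++ [q]) :: dsDecomp k' (N1.filter fun Δ => a + 1 ≤ Δ.1) := by
        rw [dsDecomp, if_neg h0, hN1', e1]
      rw [d1, d2, List.length_cons, List.length_cons, selAuxI_cons, selAuxI_cons]
      exact fin

/-- Segments starting at most at `a + 1`. -/
def low (a : ℤ) (n : Multiset Seg) : Multiset Seg := n.filter fun Δ => Δ.1 ≤ a + 1

theorem GX_low (a t : ℤ) (n : Multiset Seg) : GX a (low a n) t = GX a n t := by
  unfold GX low
  rw [Multiset.countP_filter]
  apply Multiset.countP_congr rfl
  intro x _
  exact propext ⟨fun h => h.1, fun h => ⟨h, by omega⟩⟩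

theorem GY_low (a t : ℤ) (n : Multiset Seg) : GY a (low a n) t = GY a n t := by
  unfold GY low
  rw [Multiset.countP_filter]
  apply Multiset.countP_congr rfl
  intro x _
  exact propext ⟨fun h => h.1, fun h => ⟨h, by omega⟩⟩

theorem low_add (a : ℤ) (n n' : Multiset Seg) : low a (n + n') = low a n + low a n' :=
  Multiset.filter_add _ _ _

theorem low_erase {a : ℤ} {Δ : Seg} (h : a + 2 ≤ Δ.1) (n : Multiset Seg) :
    low a (n.erase Δ) = low a n := by
  by_cases hΔ : Δ ∈ n
  · conv_rhs => rw [← Multiset.cons_erase hΔ]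
    unfold low
    rw [Multiset.filter_cons_of_neg]
    omega
  · rw [Multiset.erase_of_notMem hΔ]

theorem low_push {a x y : ℤ} (h : a + 2 ≤ x) (n : Multiset Seg) :
    low a (pushSeg n x y) = low a n := by
  unfold pushSeg
  split_ifs
  · rw [low_add]
    have : low a {(x, y)} = 0 := by
      unfold low
      rw [Multiset.filter_singleton, if_neg (by simp; omega)]; rfl
    rw [this, add_zero]
  · rfl

theorem pushSeg_add (n c : Multiset Seg) (x y : ℤ) :
    pushSeg (n + c) x y = pushSeg n x y + c := by
  unfold pushSeg
  split_ifs
  · rw [add_right_comm]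
  · rfl

/-- The extension fold of the Langlands integral algorithm. -/
def exFold (S : List (Seg × ℤ)) (n : Multiset Seg) : Multiset Seg :=
  S.foldl (fun acc p => pushSeg (acc.erase p.1) p.2 p.1.2) n

theorem exFold_nil (n : Multiset Seg) : exFold [] n = n := rfl

theorem exFold_cons (p : Seg × ℤ) (S : List (Seg × ℤ)) (n : Multiset Seg) :
    exFold (p :: S) n = exFold S (pushSeg (n.erase p.1) p.2 p.1.2) := rfl

theorem le_pushSeg (n : Multiset Seg) (x y : ℤ) : n ≤ pushSeg n x y := by
  unfold pushSeg
  split_ifs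
  · exact Multiset.le_add_right _ _
  · exact le_rfl

theorem exFold_add (c : Multiset Seg) (S : List (Seg × ℤ)) : ∀ n : Multiset Seg,
    ((S.map Prod.fst : List Seg) : Multiset Seg) ≤ n → exFold S (n + c) = exFold S n + c := by
  induction S with
  | nil => intro n _; rfl
  | cons p S ih =>
    intro n h
    rw [List.map_cons, ← Multiset.cons_coe] at h
    have hp : p.1 ∈ n := Multiset.mem_of_le h (Multiset.mem_cons_self _ _)
    rw [← Multiset.cons_erase hp, Multiset.cons_le_cons_iff] at h
    rw [exFold_cons, exFold_cons, Multiset.erase_add_left_pos _ hp, pushSeg_add]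
    exact ih _ (h.trans (le_pushSeg _ _ _))

theorem exFold_low {a : ℤ} (S : List (Seg × ℤ)) : TG a S → ∀ n : Multiset Seg,
    low a (exFold S n) = low a n := by
  induction S with
  | nil => intro _ n; rfl
  | cons p S ih =>
    intro h n
    rw [exFold_cons, ih (fun q hq => h q (List.mem_cons_of_mem _ hq))]
    have := h p List.mem_cons_self
    rw [low_push this.2, low_erase this.1]

theorem ILang_eq (a b : ℤ) (m : Multiset Seg) :
    ILang a b m =
      pushSeg (exFold (selAuxI a (dsDecomp (mRange m a b).card (mRange m a b))
        (dsDecomp (mRange m a b).card (mRange m a b)).length a) m)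
      (endPt (selAuxI a (dsDecomp (mRange m a b).card (mRange m a b))
        (dsDecomp (mRange m a b).card (mRange m a b)).length a) a) b := by
  unfold ILang endPt exFold
  dsimp only
  split <;> simp_all

theorem finish {a b w w' : ℤ} {m base n : Multiset Seg} (hm : IsMS m) (hab : a < b)
    (hH : Hall a m) (hw : b ≤ w) (hw' : b ≤ w') (hww : w' ≤ w)
    (hlow : low a n = low a m + {(a + 1, w')}) (hn : n = base + {(a + 1, w)})
    (heq : GX a m w = GY a m w)
    (hc : ∀ t, b ≤ t → GY a m t + (if t < w then 1 else 0) ≤ GX a m t + if t < w' then 1 else 0) :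
    pushSeg base a w = Irho a n := by
  have hX : ∀ t, GX a n t = GX a m t + if t < w' then 1 else 0 := by
    intro t
    rw [← GX_low, hlow, GX_add, GX_low]
    congr 1
    rw [← Multiset.cons_zero, GX, Multiset.countP_cons]; simp
  have hY : ∀ t, GY a n t = GY a m t := by
    intro t
    rw [← GY_low, hlow, GY_add, GY_low]
    simp only [← Multiset.cons_zero, GY, Multiset.countP_cons]; simp
  rw [Irho_spec hn (by omega)]
  · unfold pushSeg
    rw [if_pos (by omega)]
  · intro Δ hΔ h1
    have : Δ ∈ low a n := Multiset.mem_filter.2 ⟨hΔ, by omega⟩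
    rw [hlow, Multiset.mem_add, Multiset.mem_singleton] at this
    rcases this with h | h
    · have := hm Δ (Multiset.mem_filter.1 h).1
      omega
    · subst h; simp at h1
  · rw [hX, hY, heq, if_neg (by omega), add_zero]
  · intro t
    rw [hX, hY]
    by_cases ht : b ≤ t
    · exact hc t ht
    · have := hH t
      rw [if_pos (by omega), if_pos (by omega)]
      omega

theorem GX_mRange {a b t : ℤ} (hab : a < b) (ht : b ≤ t) (m : Multiset Seg) :
    GX a (mRange m a b) t = GX a m t := by
  unfold GX mRange
  rw [Multiset.countP_filter]
  apply Multiset.countP_congr rfl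
  intro x _
  exact propext ⟨fun h => h.1, fun h => ⟨h, by omega⟩⟩

theorem GY_mRange {a b t : ℤ} (hab : a < b) (ht : b ≤ t) (m : Multiset Seg) :
    GY a (mRange m a b) t = GY a m t := by
  unfold GY mRange
  rw [Multiset.countP_filter]
  apply Multiset.countP_congr rfl
  intro x _
  exact propext ⟨fun h => h.1, fun h => ⟨h, by omega⟩⟩

theorem mRange_succ (m : Multiset Seg) (a b : ℤ) :
    mRange m (a + 1) b = (mRange m a b).filter fun Δ => a + 1 ≤ Δ.1 := by
  unfold mRange
  rw [Multiset.filter_filter]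
  apply Multiset.filter_congr
  intro x _
  constructor
  · intro h; exact ⟨h.1, by omega, h.2.1, h.2.2⟩
  · intro h; exact ⟨h.1, h.2.2.1, h.2.2.2⟩

theorem push_pos {n : Multiset Seg} {x y : ℤ} (h : x ≤ y) : pushSeg n x y = n + {(x, y)} := by
  unfold pushSeg
  rw [if_pos h]

theorem low_single {a x y : ℤ} (h : x ≤ a + 1) : low a {(x, y)} = {(x, y)} := by
  unfold low
  rw [Multiset.filter_singleton, if_pos h]

theorem stmt6_aux (m : Multiset Seg) (hm : IsMS m) (a b : ℤ) (hab : a < b)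
    (hD : Drho a m = none) :
    ILang a b m = Irho a (ILang (a + 1) b m) := by
  have hH := hall_of_Drho hD
  have hGR : GR b (mRange m a b) := fun Δ hΔ => (Multiset.mem_filter.1 hΔ).2.2
  have hge : ∀ Δ ∈ mRange m a b, a ≤ Δ.1 := fun Δ hΔ => (Multiset.mem_filter.1 hΔ).2.1
  have hNm : mRange m a b ≤ m := Multiset.filter_le _ _
  have hYb : GY a (mRange m a b) b = CS a (mRange m a b) := GY_eq_CS fun Δ hΔ _ => (hGR Δ hΔ).2
  have hHb : GY a (mRange m a b) b ≤ GX a (mRange m a b) b := by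
    rw [GX_mRange hab le_rfl, GY_mRange hab le_rfl]; exact hH b
  have hHN : Hall a (mRange m a b) := by
    intro t
    by_cases ht : b ≤ t
    · rw [GX_mRange hab ht, GY_mRange hab ht]; exact hH t
    · have h1 := GY_le_CS a t (mRange m a b)
      have h2 := GX_anti a (mRange m a b) (s := t) (t := b) (by omega)
      omega
  have hC := main_concl a b (mRange m a b).card (mRange m a b)
    (mRange m (a + 1) b).card le_rfl (by rw [mRange_succ]) hGR hge hHN
  rw [← mRange_succ] at hC
  rw [ILang_eq, ILang_eq]
  generalize selAuxI a (dsDecomp (mRange m a b).card (mRange m a b))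
        (dsDecomp (mRange m a b).card (mRange m a b)).length a = S at hC ⊢
  generalize selAuxI (a + 1) (dsDecomp (mRange m (a + 1) b).card (mRange m (a + 1) b))
        (dsDecomp (mRange m (a + 1) b).card (mRange m (a + 1) b)).length (a + 1) = S' at hC ⊢
  obtain ⟨hle, hC⟩ := hC
  have hmem : ∀ p ∈ S, p.1 ∈ mRange m a b := fun p hp =>
    Multiset.mem_of_le hle (Multiset.mem_coe.2 (List.mem_map_of_mem hp))
  rcases hC with ⟨rfl, rfl, hCS⟩ | ⟨Δ, T, rfl, rfl, hΔ, hT, heq⟩ | ⟨x, rfl, heq, hC⟩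
  · simp only [endPt_nil, exFold_nil]
    apply finish hm hab hH (w := b) (w' := b) le_rfl le_rfl le_rfl
    · rw [push_pos (by omega), low_add, low_single le_rfl]
    · rw [push_pos (by omega)]
    · have h1 := GX_le_CS a b (mRange m a b)
      rw [← GX_mRange hab le_rfl, ← GY_mRange hab le_rfl]
      omega
    · intro t _
      have := hH t
      omega
  · have hΔN := hmem _ List.mem_cons_self
    have hΔb := (hGR _ hΔN).2
    have hΔm := Multiset.mem_of_le hNm hΔN
    simp only at hΔb hΔm
    have hTle : ((T.map Prod.fst : List Seg) : Multiset Seg) ≤ m.erase Δ := by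
      have h := hle.trans hNm
      rw [List.map_cons, ← Multiset.cons_coe, ← Multiset.cons_erase hΔm,
        Multiset.cons_le_cons_iff] at h
      exact h
    simp only [endPt_cons, exFold_cons]
    rw [push_pos (x := a) (by omega), push_pos (x := a + 1) (by omega), exFold_add _ _ _ hTle,
      exFold_add _ _ _ hTle, pushSeg_add, pushSeg_add, ← push_pos (x := a) (by omega)]
    refine finish hm hab hH hΔb hΔb le_rfl ?_ rfl ?_ ?_
    · rw [low_add, low_push (endPt_ge hT _ hΔ), exFold_low _ hT, low_erase hΔ, low_single le_rfl]
    · rw [← GX_mRange hab hΔb, ← GY_mRange hab hΔb]; exact heq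
    · intro t _
      have := hH t
      omega
  · have hxN := hmem _ List.mem_cons_self
    have hxb := (hGR _ hxN).2
    have hxm := Multiset.mem_of_le hNm hxN
    simp only at hxb hxm
    have hTle : ((S'.map Prod.fst : List Seg) : Multiset Seg) ≤ m.erase (a + 1, x) := by
      have h := hle.trans hNm
      rw [List.map_cons, ← Multiset.cons_coe, ← Multiset.cons_erase hxm,
        Multiset.cons_le_cons_iff] at h
      exact h
    have hm1 : m = m.erase (a + 1, x) + {(a + 1, x)} := by
      rw [add_comm, Multiset.singleton_add, Multiset.cons_erase hxm]
    simp only [endPt_cons, exFold_cons]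
    rw [push_pos (x := a) (by omega), exFold_add _ _ _ hTle, pushSeg_add,
      ← push_pos (x := a) (by omega)]
    have hn : pushSeg (exFold S' m) (endPt S' (a + 1)) b =
        pushSeg (exFold S' (m.erase (a + 1, x))) (endPt S' (a + 1)) b + {(a + 1, x)} := by
      conv_lhs => rw [hm1]
      rw [exFold_add _ _ _ hTle, pushSeg_add]
    have heq' : GX a m x = GY a m x := by
      rw [← GX_mRange hab hxb, ← GY_mRange hab hxb]; exact heq
    rcases hC with ⟨rfl, hc⟩ | ⟨Δ, T, rfl, hΔ, hT, hΔx, hc⟩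
    · refine finish hm hab hH hxb (w' := b) le_rfl hxb ?_ hn heq' ?_
      · rw [endPt_nil, exFold_nil, push_pos (by omega), low_add, low_single le_rfl]
      · intro t ht
        rw [← GX_mRange hab ht, ← GY_mRange hab ht]; exact hc t
    · have hΔb := (hGR _ (hmem _ (List.mem_cons_of_mem _ List.mem_cons_self))).2
      simp only at hΔb
      refine finish hm hab hH hxb (w' := Δ.2) hΔb hΔx ?_ hn heq' ?_
      · rw [endPt_cons, low_push (endPt_ge hT _ hΔ), exFold_cons, exFold_low _ hT,
          push_pos (by simp only; omega), low_add, low_erase hΔ, low_single le_rfl]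
      · intro t ht
        rw [← GX_mRange hab ht, ← GY_mRange hab ht]; exact hc t


/-- if `𝒟_{[a]}(m) = ∞` then
`ℐ^Lang_{[a,b]}(m) = ℐ_{[a]} ∘ ℐ^Lang_{[a+1,b]}(m)`. -/
theorem stmt6 (m : Multiset Seg) (hm : IsMS m) (a b : ℤ) (hab : a < b)
    (hD : Drho a m = none) :
    ILang a b m = Irho a (ILang (a + 1) b m) := by
  exact stmt6_aux m hm a b hab hD

end Multiseg
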